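/- Let Γ be a finitely generated nilpotent group and let n ≥ 1. Set X = Hom(Γ, SL_n(ℂ)) with the topology of pointwise convergence, and let A ⊆ X be the subspace of those homomorphisms ρ such that ρ(γ) is a unitary matrix (i.e. lies in SU(n)) for every γ ∈ Γ. Then there is a strong deformation retraction H : X × [0,1] → X of X onto A which is SU(n)-equivariant for the conjugation action, i.e. H(u·ρ(·)·u⁻¹, t) = u·H(ρ, t)(·)·u⁻¹ for every u ∈ SU(n), every ρ ∈ X and every t ∈ [0,1]. -/

import Mathlib

open Matrix

/-- The representation space `Hom(Γ, SL_n ℂ)`, realized as the subspace of the product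
space `Γ → Matrix (Fin n) (Fin n) ℂ` (with the topology of pointwise convergence)
consisting of the maps that are group homomorphisms into the determinant-one matrices. -/
abbrev RepSL (Γ : Type) [Group Γ] (n : ℕ) : Type :=
  {f : Γ → Matrix (Fin n) (Fin n) ℂ //
    f 1 = 1 ∧ (∀ γ₁ γ₂, f (γ₁ * γ₂) = f γ₁ * f γ₂) ∧ (∀ γ, (f γ).det = 1)}

section Descent

open Filter Topology

/-- The cut-off time `max 0 (1 - (k + 1) (1 - t))` of the `k`-th step of a concatenated homotopy. -/
noncomputable def stepTime (k : ℕ) (t : unitInterval) : unitInterval :=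
  Set.projIcc 0 1 zero_le_one (1 - ((k : ℝ) + 1) * (1 - (t : ℝ)))

theorem continuous_stepTime (k : ℕ) : Continuous (stepTime k) := by
  unfold stepTime
  exact continuous_projIcc.comp (by fun_prop)

theorem stepTime_eq_zero {k : ℕ} {t : unitInterval} (h : 1 ≤ ((k : ℝ) + 1) * (1 - (t : ℝ))) :
    stepTime k t = 0 :=
  Set.projIcc_of_le_left _ (by linarith)

theorem stepTime_one (k : ℕ) : stepTime k 1 = 1 :=
  Set.projIcc_of_right_le _ (by simp)

/-- The composition of the first `k` steps of a homotopy, the `j`-th one run for `stepTime j t`. -/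
noncomputable def stepIter {X : Type*} (Φ : X × unitInterval → X) : ℕ → X × unitInterval → X
  | 0, p => p.1
  | k + 1, p => Φ (stepIter Φ k p, stepTime k p.2)

theorem stepIter_eq_of_stepTime {X : Type*} {Φ : X × unitInterval → X}
    (h0 : ∀ x, Φ (x, 0) = x) {p : X × unitInterval} {k m : ℕ}
    (hk : 1 ≤ ((k : ℝ) + 1) * (1 - (p.2 : ℝ))) (h : k ≤ m) :
    stepIter Φ m p = stepIter Φ k p := by
  induction m, h using Nat.le_induction with
  | base => rfl
  | succ m hm ih =>
    have h1 : stepTime m p.2 = 0 := by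
      apply stepTime_eq_zero
      have h2 : (k : ℝ) ≤ m := by exact_mod_cast hm
      nlinarith [p.2.2.2]
    change Φ (stepIter Φ m p, stepTime m p.2) = _
    rw [h1, h0, ih]

variable {X : Type*} [MetricSpace X] {Φ : X × unitInterval → X} {y : X → ℝ}

theorem continuous_stepIter (hΦ : Continuous Φ) (k : ℕ) : Continuous (stepIter Φ k) := by
  induction k with
  | zero => exact continuous_fst
  | succ k ih => exact hΦ.comp (ih.prodMk ((continuous_stepTime k).comp continuous_snd))

theorem dist_stepIter_le (hd : ∀ x s, dist x (Φ (x, s)) ≤ y x - y (Φ (x, s)))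
    (p : X × unitInterval) {k m : ℕ} (h : k ≤ m) :
    dist (stepIter Φ k p) (stepIter Φ m p) ≤ y (stepIter Φ k p) - y (stepIter Φ m p) := by
  induction m, h using Nat.le_induction with
  | base => simp
  | succ m _ ih =>
    have h1 := dist_triangle (stepIter Φ k p) (stepIter Φ m p) (stepIter Φ (m + 1) p)
    have h2 : dist (stepIter Φ m p) (stepIter Φ (m + 1) p)
      ≤ y (stepIter Φ m p) - y (stepIter Φ (m + 1) p) := hd _ _
    linarith

theorem exists_tendsto_stepIter [CompleteSpace X] (hy0 : ∀ x, 0 ≤ y x)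
    (hd : ∀ x s, dist x (Φ (x, s)) ≤ y x - y (Φ (x, s))) (p : X × unitInterval) :
    ∃ a, Tendsto (fun k => stepIter Φ k p) atTop (𝓝 a) := by
  apply cauchySeq_tendsto_of_complete
  refine cauchySeq_of_summable_dist (summable_of_sum_range_le (c := y p.1)
    (fun _ => dist_nonneg) fun N => ?_)
  have : ∀ N, ∑ k ∈ Finset.range N, dist (stepIter Φ k p) (stepIter Φ (k + 1) p)
      ≤ y p.1 - y (stepIter Φ N p) := by
    intro N
    induction N with
    | zero => simp [stepIter]
    | succ N ih =>
      rw [Finset.sum_range_succ]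
      linarith [dist_stepIter_le hd p (Nat.le_succ N)]
  linarith [this N, hy0 (stepIter Φ N p)]

/-- A homotopy `Φ` whose displacement is controlled by the decrease of a Lyapunov function `y`,
and whose time-one map has fixed points only in the zero set of `y`, can be iterated to a strong
deformation retraction onto the zero set of `y`. -/
theorem exists_deformation_of_descent [CompleteSpace X]
    (hΦ : Continuous Φ) (hy : Continuous y) (hy0 : ∀ x, 0 ≤ y x)
    (hd : ∀ x s, dist x (Φ (x, s)) ≤ y x - y (Φ (x, s)))
    (h0 : ∀ x, Φ (x, 0) = x) (h1 : ∀ x, Φ (x, 1) = x → y x = 0) :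
    ∃ H : X × unitInterval → X, Continuous H ∧ (∀ x, H (x, 0) = x) ∧ (∀ x, y (H (x, 1)) = 0) ∧
      (∀ x, y x = 0 → ∀ t, H (x, t) = x) ∧
      ∀ σ : X → X, Continuous σ → (∀ x s, σ (Φ (x, s)) = Φ (σ x, s)) →
        ∀ x t, σ (H (x, t)) = H (σ x, t) := by
  choose H hH using exists_tendsto_stepIter hy0 hd
  have hyH : ∀ x, y (H (x, 1)) = 0 := by
    intro x
    apply h1
    have a1 := (hΦ.tendsto (H (x, 1), 1)).comp ((hH (x, 1)).prodMk_nhds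
      (tendsto_const_nhds (x := (1 : unitInterval))))
    refine tendsto_nhds_unique a1 ((tendsto_add_atTop_iff_nat 1).2 (hH (x, 1)) |>.congr ?_)
    intro k
    simp [stepIter, stepTime_one]
  have htail : ∀ k p, dist (stepIter Φ k p) (H p) ≤ y (stepIter Φ k p) := by
    intro k p
    refine le_of_tendsto (tendsto_const_nhds.dist (hH p)) ?_
    filter_upwards [eventually_ge_atTop k] with m hm
    linarith [dist_stepIter_le hd p hm, hy0 (stepIter Φ m p)]
  have hfix : ∀ x, y x = 0 → ∀ t, Φ (x, t) = x := by
    intro x hx t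
    have := hd x t
    have h3 := hy0 (Φ (x, t))
    exact (dist_le_zero.1 (by linarith)).symm
  refine ⟨H, ?_, ?_, hyH, ?_, ?_⟩
  · refine continuous_of_locally_uniform_approx_of_continuousAt fun p u hu => ?_
    obtain ⟨ε, hε, hu⟩ := Metric.mem_uniformity_dist.1 hu
    by_cases hp : p.2 = 1
    · have hy1 : y (H p) = 0 := by
        have : p = (p.1, 1) := by rw [← hp]
        rw [this]; exact hyH _
      have a1 : Tendsto (fun k => y (stepIter Φ k p)) atTop (𝓝 0) := by
        rw [← hy1]; exact (hy.tendsto _).comp (hH p)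
      obtain ⟨k, hk⟩ := (a1.eventually_lt_const hε).exists
      have a2 : Continuous fun q => y (stepIter Φ k q) := hy.comp (continuous_stepIter hΦ k)
      refine ⟨_, (a2.tendsto p).eventually_lt_const hk, stepIter Φ k,
        (continuous_stepIter hΦ k).continuousAt, fun q hq => hu ?_⟩
      rw [dist_comm]
      exact (htail k q).trans_lt hq
    · have hp' : 0 < 1 - (p.2 : ℝ) := by
        have : (p.2 : ℝ) ≠ 1 := fun h => hp (Subtype.ext h)
        have := lt_of_le_of_ne p.2.2.2 this
        linarith
      obtain ⟨k, hk⟩ := exists_nat_gt (1 / (1 - (p.2 : ℝ)))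
      have hk1 : 1 < ((k : ℝ) + 1) * (1 - (p.2 : ℝ)) := by
        rw [div_lt_iff₀ hp'] at hk
        nlinarith
      have a2 : Continuous fun q : X × unitInterval => ((k : ℝ) + 1) * (1 - (q.2 : ℝ)) := by
        fun_prop
      refine ⟨_, (a2.tendsto p).eventually_const_lt hk1, stepIter Φ k,
        (continuous_stepIter hΦ k).continuousAt, fun q hq => hu ?_⟩
      have : H q = stepIter Φ k q := by
        refine tendsto_nhds_unique (hH q) (tendsto_const_nhds.congr' ?_)
        filter_upwards [eventually_ge_atTop k] with m hm
        exact (stepIter_eq_of_stepTime h0 (le_of_lt hq) hm).symm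
      rw [this, dist_self]
      exact hε
  · intro x
    refine tendsto_nhds_unique (hH (x, 0)) (tendsto_const_nhds.congr fun m => ?_)
    exact (stepIter_eq_of_stepTime (p := (x, 0)) (k := 0) h0 (by simp) (Nat.zero_le m)).symm
  · intro x hx t
    refine tendsto_nhds_unique (hH (x, t)) (tendsto_const_nhds.congr fun m => ?_)
    induction m with
    | zero => rfl
    | succ m ih => simp only [stepIter]; rw [← ih, hfix x hx]
  · intro σ hσ hc x t
    refine tendsto_nhds_unique ((hσ.tendsto _).comp (hH (x, t))) ((hH (σ x, t)).congr fun m => ?_)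
    induction m with
    | zero => rfl
    | succ m ih => simp only [stepIter, Function.comp] at ih ⊢; rw [hc, ih]

end Descent

section Balanced

variable {n : Type*} [Fintype n]

theorem pow_three_le_of_balanced_of_pos {m : n → ℝ} {a : n → n → ℝ} (ha : ∀ j k, 0 ≤ a j k)
    (hm : ∀ j, m j = ∑ k, (a j k - a k j)) (i : n) (hi : 0 < m i) :
    m i ^ 3 ≤ ((Fintype.card n : ℝ) + 1) ^ 2 * ∑ j, ∑ k, (m j - m k) ^ 2 * a j k := by
  classical
  set d := Fintype.card n with hd
  set g : ℝ := m i / (d + 1) with hg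
  have hd1 : (0 : ℝ) < d + 1 := by positivity
  have hg0 : 0 < g := by positivity
  let T : ℕ → Finset n := fun k => Finset.univ.filter fun j => k * g < m j
  have hT : ∀ k, T (k + 1) ⊆ T k := fun k j hj => by
    simp only [T, Finset.mem_filter, Finset.mem_univ, true_and] at hj ⊢
    push_cast at hj
    linarith
  have hiT : ∀ k ≤ d, i ∈ T k := fun k hk => by
    simp only [T, Finset.mem_filter, Finset.mem_univ, true_and]
    have h1 : (k : ℝ) ≤ d := by exact_mod_cast hk
    rw [hg, mul_div_assoc', div_lt_iff₀ hd1]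
    nlinarith
  obtain ⟨k, hk, hkT⟩ : ∃ k < d, T k = T (k + 1) := by
    by_contra! hne
    have : ∀ k ≤ d, (T k).card + k ≤ d := by
      intro k hk
      induction k with
      | zero => simpa using Finset.card_le_univ (T 0)
      | succ k ih =>
        have h1 := ih (by omega)
        have h2 := Finset.card_lt_card ((hT k).ssubset_of_ne (hne k (by omega)).symm)
        omega
    have h1 := this d le_rfl
    have h2 := Finset.card_pos.2 ⟨i, hiT d le_rfl⟩
    omega
  have htop : ∀ j ∈ T k, (k + 1) * g < m j := fun j hj => by
    rw [hkT] at hj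
    simpa [T] using hj
  have hbot : ∀ j ∉ T k, m j ≤ k * g := fun j hj => by simpa [T] using hj
  let f : n → ℝ := fun j => if j ∈ T k then 1 else 0
  have hsum : ∑ j, f j * m j = ∑ j, ∑ l, (f j - f l) * a j l := by
    have h1 : ∑ j, ∑ l, f l * a j l = ∑ j, ∑ l, f j * a l j := Finset.sum_comm
    simp_rw [sub_mul, Finset.sum_sub_distrib, h1, hm, Finset.mul_sum, mul_sub,
      Finset.sum_sub_distrib]
  have hle : ∀ j l, (f j - f l) * a j l ≤ (g ^ 2)⁻¹ * ((m j - m l) ^ 2 * a j l) := by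
    intro j l
    rw [← mul_assoc]
    refine mul_le_mul_of_nonneg_right ?_ (ha j l)
    by_cases hj : j ∈ T k <;> by_cases hl : l ∈ T k
    · simp only [f, hj, hl, if_true, sub_self]; positivity
    · simp only [f, hj, hl, if_true, if_false, sub_zero]
      have := htop j hj
      have := hbot l hl
      rw [inv_mul_eq_div, one_le_div (by positivity)]
      exact pow_le_pow_left₀ hg0.le (by linarith) 2
    · simp only [f, hj, hl, if_true, if_false, zero_sub]
      have : 0 ≤ (g ^ 2)⁻¹ * (m j - m l) ^ 2 := by positivity
      linarith
    · simp only [f, hj, hl, if_false, sub_self]; positivity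
  have hge : m i ≤ ∑ j, f j * m j := by
    have h1 : f i * m i = m i := by simp [f, hiT k hk.le]
    rw [← h1]
    refine Finset.single_le_sum (f := fun j => f j * m j) (fun j _ => ?_) (Finset.mem_univ i)
    by_cases hj : j ∈ T k
    · have := htop j hj
      simp only [f, hj, if_true, one_mul]
      exact le_of_lt (lt_of_le_of_lt (by positivity) this)
    · simp [f, hj]
  have h2 : m i ≤ (g ^ 2)⁻¹ * ∑ j, ∑ l, (m j - m l) ^ 2 * a j l := by
    rw [hsum] at hge
    refine hge.trans ?_
    simp_rw [Finset.mul_sum]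
    exact Finset.sum_le_sum fun j _ => Finset.sum_le_sum fun l _ => hle j l
  rw [inv_mul_eq_div, le_div_iff₀ (by positivity), hg, div_pow, mul_div_assoc',
    div_le_iff₀ (by positivity)] at h2
  linarith

theorem abs_pow_three_le_of_balanced {m : n → ℝ} {a : n → n → ℝ} (ha : ∀ j k, 0 ≤ a j k)
    (hm : ∀ j, m j = ∑ k, (a j k - a k j)) (i : n) :
    |m i| ^ 3 ≤ ((Fintype.card n : ℝ) + 1) ^ 2 * ∑ j, ∑ k, (m j - m k) ^ 2 * a j k := by
  rcases lt_trichotomy (m i) 0 with h | h | h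
  · have := pow_three_le_of_balanced_of_pos (m := fun j => - m j) (a := fun j k => a k j)
      (fun j k => ha k j) (fun j => by rw [hm, ← Finset.sum_neg_distrib]; simp) i (by linarith)
    rw [abs_of_neg h]
    convert this using 2
    rw [Finset.sum_comm]
    refine Finset.sum_congr rfl fun j _ => Finset.sum_congr rfl fun k _ => ?_
    ring
  · rw [h]
    have : 0 ≤ ∑ j, ∑ k, (m j - m k) ^ 2 * a j k :=
      Finset.sum_nonneg fun j _ => Finset.sum_nonneg fun k _ => mul_nonneg (sq_nonneg _) (ha j k)
    rw [abs_zero, zero_pow three_ne_zero]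
    positivity
  · rw [abs_of_pos h]
    exact pow_three_le_of_balanced_of_pos ha hm i h

/-- The strict convexity underlying uniqueness of minimal vectors, in diagonal coordinates. -/
theorem eq_of_balanced_of_sum_div {r : n → ℝ} (hr : ∀ j, 0 < r j) {a : n → n → ℝ}
    (ha : ∀ j k, 0 ≤ a j k) (hm : ∀ j, ∑ k, (a j k - a k j) = 0)
    (hs : ∑ j, ∑ k, r k / r j * a j k = ∑ j, ∑ k, a j k) (j k : n) (hjk : a j k ≠ 0) :
    r j = r k := by
  have hlog : ∑ j, ∑ k, (Real.log (r k) - Real.log (r j)) * a j k = 0 := by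
    have h1 : ∑ j, ∑ k, Real.log (r k) * a j k = ∑ j, ∑ k, Real.log (r j) * a k j :=
      Finset.sum_comm
    simp_rw [sub_mul, Finset.sum_sub_distrib, h1, ← Finset.sum_sub_distrib, ← mul_sub,
      ← Finset.mul_sum]
    refine Finset.sum_eq_zero fun j _ => ?_
    have : ∑ k, (a k j - a j k) = 0 := by
      rw [← neg_eq_zero, ← Finset.sum_neg_distrib, ← hm j]; simp
    rw [this, mul_zero]
  have hnn : ∀ j k, 0 ≤ (r k / r j - 1 - (Real.log (r k) - Real.log (r j))) * a j k := by
    intro j k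
    refine mul_nonneg ?_ (ha j k)
    rw [← Real.log_div (hr k).ne' (hr j).ne']
    linarith [Real.log_le_sub_one_of_pos (div_pos (hr k) (hr j))]
  have hz : ∑ j, ∑ k, (r k / r j - 1 - (Real.log (r k) - Real.log (r j))) * a j k = 0 := by
    simp_rw [sub_mul _ _ (a _ _), Finset.sum_sub_distrib, one_mul] at hlog ⊢
    rw [hs, hlog]; ring
  rw [Finset.sum_eq_zero_iff_of_nonneg fun j _ => Finset.sum_nonneg fun k _ => hnn j k] at hz
  have h1 := hz j (Finset.mem_univ j)
  rw [Finset.sum_eq_zero_iff_of_nonneg fun k _ => hnn j k] at h1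
  have h2 := (mul_eq_zero.1 (h1 k (Finset.mem_univ k))).resolve_right hjk
  rw [← Real.log_div (hr k).ne' (hr j).ne'] at h2
  by_contra hne
  have h3 : r k / r j ≠ 1 := fun h => hne ((div_eq_one_iff_eq (hr j).ne').1 h).symm
  linarith [Real.log_lt_sub_one_of_pos (div_pos (hr k) (hr j)) h3]

end Balanced

section Moment

open scoped Matrix.Norms.Frobenius

variable {n ι : Type*} [Fintype n] [DecidableEq n] [Fintype ι]

theorem frobenius_sq_eq_sum (X : Matrix n n ℂ) : ‖X‖ ^ 2 = ∑ j, ∑ k, ‖X j k‖ ^ 2 := by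
  rw [Matrix.frobenius_norm_def, ← Real.sqrt_eq_rpow, Real.sq_sqrt (by positivity)]
  norm_cast

omit [DecidableEq n] in
theorem re_trace_conjTranspose_mul (X Y : Matrix n n ℂ) :
    (trace (Xᴴ * Y)).re = ∑ j, ∑ k, (star (X j k) * Y j k).re := by
  rw [Finset.sum_comm]
  simp [trace, Matrix.mul_apply]

theorem frobenius_sq_eq_trace (X : Matrix n n ℂ) : ‖X‖ ^ 2 = (trace (Xᴴ * X)).re := by
  rw [frobenius_sq_eq_sum, re_trace_conjTranspose_mul]
  refine Finset.sum_congr rfl fun j _ => Finset.sum_congr rfl fun k _ => ?_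
  rw [Complex.sq_norm, Complex.normSq_apply]
  simp

omit [DecidableEq n] in
theorem re_trace_conjTranspose_mul_comm (X Y : Matrix n n ℂ) :
    (trace (Yᴴ * X)).re = (trace (Xᴴ * Y)).re := by
  rw [← conjTranspose_conjTranspose X, ← conjTranspose_mul, trace_conjTranspose,
    conjTranspose_conjTranspose]
  simp

theorem frobenius_add_sq (X Y : Matrix n n ℂ) :
    ‖X + Y‖ ^ 2 = ‖X‖ ^ 2 + 2 * (trace (Xᴴ * Y)).re + ‖Y‖ ^ 2 := by
  simp only [frobenius_sq_eq_trace, conjTranspose_add, add_mul, mul_add, trace_add,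
    Complex.add_re]
  linarith [re_trace_conjTranspose_mul_comm X Y]

theorem re_trace_conjTranspose_mul_le (X Y : Matrix n n ℂ) :
    (trace (Xᴴ * Y)).re ≤ ‖X‖ * ‖Y‖ := by
  have h1 := frobenius_add_sq X Y
  have h2 := pow_le_pow_left₀ (norm_nonneg _) (norm_add_le X Y) 2
  nlinarith

theorem frobenius_norm_unitary_mul {U : Matrix n n ℂ} (hU : U ∈ unitaryGroup n ℂ)
    (X : Matrix n n ℂ) : ‖U * X‖ = ‖X‖ := by
  have h : Uᴴ * U = 1 := mem_unitaryGroup_iff'.1 hU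
  rw [← sq_eq_sq₀ (norm_nonneg _) (norm_nonneg _), frobenius_sq_eq_trace, frobenius_sq_eq_trace,
    conjTranspose_mul, Matrix.mul_assoc, ← Matrix.mul_assoc Uᴴ, h, Matrix.one_mul]

theorem frobenius_norm_mul_unitary {U : Matrix n n ℂ} (hU : U ∈ unitaryGroup n ℂ)
    (X : Matrix n n ℂ) : ‖X * U‖ = ‖X‖ := by
  rw [← frobenius_norm_conjTranspose, conjTranspose_mul,
    frobenius_norm_unitary_mul (U := Uᴴ) (Unitary.star_mem hU), frobenius_norm_conjTranspose]

/-- The moment map of the conjugation action on tuples of matrices. -/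
noncomputable def moment (A : ι → Matrix n n ℂ) : Matrix n n ℂ :=
  ∑ i, (A i * (A i)ᴴ - (A i)ᴴ * A i)

omit [DecidableEq n] in
theorem isHermitian_moment (A : ι → Matrix n n ℂ) : (moment A).IsHermitian := by
  simp [IsHermitian, moment, conjTranspose_sum]

theorem moment_unitary_conj {U : Matrix n n ℂ} (hU : U ∈ unitaryGroup n ℂ)
    (A : ι → Matrix n n ℂ) : moment (fun i => U * A i * Uᴴ) = U * moment A * Uᴴ := by
  have h : Uᴴ * U = 1 := mem_unitaryGroup_iff'.1 hU
  simp only [moment, Matrix.mul_sum, Matrix.sum_mul]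
  refine Finset.sum_congr rfl fun i _ => ?_
  simp only [conjTranspose_mul, conjTranspose_conjTranspose, mul_sub, sub_mul]
  congr 1
  · calc U * A i * Uᴴ * (U * ((A i)ᴴ * Uᴴ)) = U * A i * (Uᴴ * U) * (A i)ᴴ * Uᴴ := by noncomm_ring
      _ = _ := by rw [h]; noncomm_ring
  · calc U * ((A i)ᴴ * Uᴴ) * (U * A i * Uᴴ) = U * (A i)ᴴ * (Uᴴ * U) * A i * Uᴴ := by noncomm_ring
      _ = _ := by rw [h]; noncomm_ring

omit [DecidableEq n] in
theorem moment_apply_self (A : ι → Matrix n n ℂ) (j : n) :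
    (moment A j j).re = ∑ k, ((∑ i, ‖A i j k‖ ^ 2) - ∑ i, ‖A i k j‖ ^ 2) := by
  simp only [moment, Matrix.sum_apply, Complex.re_sum, ← Finset.sum_sub_distrib]
  rw [Finset.sum_comm]
  refine Finset.sum_congr rfl fun i _ => ?_
  simp only [Matrix.sub_apply, mul_apply, conjTranspose_apply, Complex.sub_re, Complex.re_sum,
    ← Finset.sum_sub_distrib]
  refine Finset.sum_congr rfl fun k _ => ?_
  simp only [Complex.sq_norm, Complex.normSq_apply]
  simp

theorem exists_unitary_diagonal {M : Matrix n n ℂ} (hM : M.IsHermitian) :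
    ∃ U ∈ unitaryGroup n ℂ, M = U * diagonal (fun j => (hM.eigenvalues j : ℂ)) * Uᴴ := by
  refine ⟨hM.eigenvectorUnitary, hM.eigenvectorUnitary.2, ?_⟩
  conv_lhs => rw [hM.spectral_theorem]
  rfl

theorem sum_frobenius_sq (A : ι → Matrix n n ℂ) :
    ∑ i, ‖A i‖ ^ 2 = ∑ j, ∑ k, ∑ i, ‖A i j k‖ ^ 2 := by
  simp_rw [frobenius_sq_eq_sum]
  rw [Finset.sum_comm]
  exact Finset.sum_congr rfl fun j _ => Finset.sum_comm

theorem frobenius_moment_pow_three_le_of_diagonal {A : ι → Matrix n n ℂ} {m : n → ℝ}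
    (hA : moment A = diagonal fun j => (m j : ℂ)) :
    ‖moment A‖ ^ 3 ≤ (Fintype.card n : ℝ) ^ 3 * ((Fintype.card n : ℝ) + 1) ^ 2 *
      ∑ i, ‖moment A * A i - A i * moment A‖ ^ 2 := by
  have hm : ∀ j, m j = ∑ k, ((∑ i, ‖A i j k‖ ^ 2) - ∑ i, ‖A i k j‖ ^ 2) := fun j => by
    rw [← moment_apply_self, hA]; simp
  have hδ : ∑ i, ‖moment A * A i - A i * moment A‖ ^ 2
      = ∑ j, ∑ k, (m j - m k) ^ 2 * ∑ i, ‖A i j k‖ ^ 2 := by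
    rw [sum_frobenius_sq]
    refine Finset.sum_congr rfl fun j _ => Finset.sum_congr rfl fun k _ => ?_
    rw [Finset.mul_sum]
    refine Finset.sum_congr rfl fun i _ => ?_
    rw [hA, Matrix.sub_apply, diagonal_mul, mul_diagonal, mul_comm (A i j k), ← sub_mul, norm_mul,
      mul_pow,
      ← Complex.ofReal_sub, Complex.norm_real, Real.norm_eq_abs, sq_abs]
  have key := abs_pow_three_le_of_balanced (a := fun j k => ∑ i, ‖A i j k‖ ^ 2)
    (fun j k => by positivity) hm
  rcases isEmpty_or_nonempty n with hn | hn
  · have : moment A = 0 := Subsingleton.elim _ _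
    rw [this, norm_zero, zero_pow three_ne_zero]
    exact mul_nonneg (by positivity) (Finset.sum_nonneg fun i _ => sq_nonneg _)
  obtain ⟨j, -, hj⟩ := Finset.exists_max_image Finset.univ (fun j => |m j|) Finset.univ_nonempty
  have h1 : ‖moment A‖ ≤ Fintype.card n * |m j| := by
    rw [← sq_le_sq₀ (norm_nonneg _) (by positivity), frobenius_sq_eq_sum, hA]
    have h2 : ∀ k, ∑ l, ‖(diagonal fun j => (m j : ℂ)) k l‖ ^ 2 = |m k| ^ 2 := fun k => by
      rw [Finset.sum_eq_single k]
      · simp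
      · intro l _ hl
        rw [diagonal_apply_ne _ hl.symm]; simp
      · simp
    simp_rw [h2]
    calc ∑ k, |m k| ^ 2 ≤ ∑ _k : n, |m j| ^ 2 :=
          Finset.sum_le_sum fun k hk => pow_le_pow_left₀ (abs_nonneg _) (hj k hk) 2
      _ = Fintype.card n * |m j| ^ 2 := by simp
      _ ≤ (Fintype.card n * |m j|) ^ 2 := by
        rw [mul_pow]
        refine mul_le_mul_of_nonneg_right ?_ (by positivity)
        have : (1 : ℝ) ≤ Fintype.card n := by exact_mod_cast Fintype.card_pos
        nlinarith
  calc ‖moment A‖ ^ 3 ≤ (Fintype.card n * |m j|) ^ 3 := pow_le_pow_left₀ (norm_nonneg _) h1 3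
    _ = (Fintype.card n : ℝ) ^ 3 * |m j| ^ 3 := mul_pow _ _ _
    _ ≤ _ := by
      rw [mul_assoc, hδ]
      exact mul_le_mul_of_nonneg_left (key j) (by positivity)

/-- The gradient inequality for the squared norm of the moment map. -/
theorem frobenius_moment_pow_three_le (A : ι → Matrix n n ℂ) :
    ‖moment A‖ ^ 3 ≤ (Fintype.card n : ℝ) ^ 3 * ((Fintype.card n : ℝ) + 1) ^ 2 *
      ∑ i, ‖moment A * A i - A i * moment A‖ ^ 2 := by
  obtain ⟨U, hU, hM⟩ := exists_unitary_diagonal (isHermitian_moment A)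
  have hU' : Uᴴ ∈ unitaryGroup n ℂ := Unitary.star_mem hU
  have h : Uᴴ * U = 1 := mem_unitaryGroup_iff'.1 hU
  have h' : U * Uᴴ = 1 := mem_unitaryGroup_iff.1 hU
  set D := diagonal (fun j => ((isHermitian_moment A).eigenvalues j : ℂ))
  have hc : ∀ X : Matrix n n ℂ, ‖Uᴴ * X * U‖ = ‖X‖ := fun X => by
    rw [frobenius_norm_mul_unitary hU, frobenius_norm_unitary_mul hU']
  have h1 : moment (fun i => Uᴴ * A i * U) = Uᴴ * moment A * U := by
    simpa using moment_unitary_conj hU' A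
  have h2 : Uᴴ * moment A * U = D := by
    calc Uᴴ * moment A * U = (Uᴴ * U) * D * (Uᴴ * U) := by rw [hM]; noncomm_ring
      _ = D := by rw [h, Matrix.one_mul, Matrix.mul_one]
  have := frobenius_moment_pow_three_le_of_diagonal (h1.trans h2)
  rw [h1, hc] at this
  convert this using 3 with i
  rw [← hc]
  congr 2
  calc Uᴴ * (moment A * A i - A i * moment A) * U
      = Uᴴ * (moment A * 1 * A i - A i * 1 * moment A) * U := by rw [Matrix.mul_one, Matrix.mul_one]
    _ = _ := by rw [← h']; noncomm_ring

end Moment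

section Step

open scoped Matrix.Norms.Frobenius

variable {n ι : Type*} [Fintype n] [DecidableEq n] [Fintype ι]

theorem le_sqrt_mul_sub_of_descent {x x' C ε δ e : ℝ} (hx : 0 ≤ x) (hx' : 0 ≤ x') (hC : 0 ≤ C)
    (hε : 0 ≤ ε) (hδ : 0 ≤ δ) (h1 : x ^ 6 ≤ C * δ ^ 2) (h2 : x' ^ 4 ≤ x ^ 4 - 2 * ε * δ ^ 2)
    (h3 : e ≤ 2 * ε * δ) : e ≤ 4 * √C * (x - x') := by
  have hxx : x' ≤ x := by
    refine (pow_le_pow_iff_left₀ hx' hx (by norm_num : 4 ≠ 0)).1 (h2.trans ?_)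
    have : 0 ≤ 2 * ε * δ ^ 2 := by positivity
    linarith
  have h4 : x ^ 3 ≤ √C * δ := by
    refine (pow_le_pow_iff_left₀ (by positivity) (by positivity) (two_ne_zero)).1 ?_
    rw [mul_pow, Real.sq_sqrt hC, ← pow_mul]
    exact h1
  have h5 : x ^ 4 - x' ^ 4 ≤ 4 * x ^ 3 * (x - x') := by
    have e1 : x ^ 4 - x' ^ 4 = (x ^ 3 + x ^ 2 * x' + x * x' ^ 2 + x' ^ 3) * (x - x') := by ring
    rw [e1]
    refine mul_le_mul_of_nonneg_right ?_ (by linarith)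
    have a1 : x ^ 2 * x' ≤ x ^ 2 * x := by gcongr
    have a2 : x * x' ^ 2 ≤ x * x ^ 2 := by gcongr
    have a3 : x' ^ 3 ≤ x ^ 3 := by gcongr
    nlinarith
  rcases hδ.eq_or_lt with h | h
  · rw [← h, mul_zero] at h3
    exact h3.trans (mul_nonneg (by positivity) (by linarith))
  · have h6 : 2 * ε * δ * δ ≤ 4 * √C * (x - x') * δ := by
      have : 4 * x ^ 3 * (x - x') ≤ 4 * (√C * δ) * (x - x') := by
        gcongr
      nlinarith
    exact h3.trans (le_of_mul_le_mul_right h6 h)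

theorem descent_estimate {S ε d e L q F x y : ℝ} (hS : 0 ≤ S) (hε : 0 ≤ ε) (hd : 0 ≤ d)
    (he : 0 ≤ e) (h1 : ε * S ≤ 1 / 200) (h2 : e ≤ 4 * ε ^ 2 * d) (h3 : d ≤ 16 * S ^ 3)
    (h4 : L ≤ 16 * (S * e)) (hq : 0 ≤ q) (h5 : q ≤ 2 * e) (h6 : F ≤ 2 * L + 2 * q ^ 2)
    (h7 : x ≤ -(9 / 5) * ε * d) (h8 : y ≤ 2 * S * (2 * e)) : 2 * (x + y) + F ≤ -(2 * ε * d) := by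
  have he2S : e ≤ S := by
    have h1 : ε ^ 2 * S ^ 2 ≤ (1 / 200) ^ 2 := by
      rw [← mul_pow]; gcongr
    calc e ≤ 4 * ε ^ 2 * (16 * S ^ 3) := h2.trans (by gcongr)
      _ = 64 * (ε ^ 2 * S ^ 2) * S := by ring
      _ ≤ 64 * (1 / 200) ^ 2 * S := by gcongr
      _ ≤ S := by linarith
  have hQ2 : q ^ 2 ≤ 4 * (S * e) := by
    calc q ^ 2 ≤ (2 * e) ^ 2 := by gcongr
      _ = 4 * (e * e) := by ring
      _ ≤ _ := by gcongr
  have hfin : S * e ≤ 1 / 50 * (ε * d) := by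
    calc S * e ≤ S * (4 * ε ^ 2 * d) := by gcongr
      _ = 4 * (ε * S) * (ε * d) := by ring
      _ ≤ 4 * (1 / 200) * (ε * d) := by gcongr
      _ = _ := by ring
  have hεd : 0 ≤ ε * d := mul_nonneg hε hd
  linarith

theorem frobenius_moment_le (A : ι → Matrix n n ℂ) : ‖moment A‖ ≤ 2 * ∑ i, ‖A i‖ ^ 2 := by
  rw [Finset.mul_sum]
  refine (norm_sum_le _ _).trans (Finset.sum_le_sum fun i _ => (norm_sub_le _ _).trans ?_)
  have h1 := frobenius_norm_mul (A i) (A i)ᴴ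
  have h2 := frobenius_norm_mul (A i)ᴴ (A i)
  rw [frobenius_norm_conjTranspose] at h1 h2
  linarith

omit [DecidableEq n] in
theorem moment_add (A E : ι → Matrix n n ℂ) :
    moment (fun i => A i + E i) = moment A +
      ((∑ i, (A i * (E i)ᴴ + E i * (A i)ᴴ - (A i)ᴴ * E i - (E i)ᴴ * A i)) + moment E) := by
  simp only [moment, ← Finset.sum_add_distrib]
  refine Finset.sum_congr rfl fun i _ => ?_
  simp only [conjTranspose_add]
  noncomm_ring

omit [DecidableEq n] in
theorem re_trace_mul_moment_derivative {M : Matrix n n ℂ} (hM : M.IsHermitian)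
    (A E : Matrix n n ℂ) :
    (trace (Mᴴ * (A * Eᴴ + E * Aᴴ - Aᴴ * E - Eᴴ * A))).re =
      2 * (trace ((M * A - A * M)ᴴ * E)).re := by
  have hM' : Mᴴ = M := hM
  have key : ∀ X Y : Matrix n n ℂ, (trace (M * (X * Yᴴ))).re = (trace (M * (Y * Xᴴ))).re := by
    intro X Y
    have : (M * (X * Yᴴ))ᴴ = Y * Xᴴ * M := by simp [hM', conjTranspose_mul]
    rw [trace_mul_comm M (Y * Xᴴ), ← this, trace_conjTranspose]
    simp
  have k1 := key A E
  have k2 := key Eᴴ Aᴴ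
  rw [conjTranspose_conjTranspose, conjTranspose_conjTranspose] at k2
  have t1 : trace (M * (E * Aᴴ)) = trace (Aᴴ * M * E) := by
    rw [← Matrix.mul_assoc, trace_mul_comm, ← Matrix.mul_assoc]
  have t2 : trace (M * (Aᴴ * E)) = trace (M * Aᴴ * E) := by rw [Matrix.mul_assoc]
  simp only [hM', mul_add, mul_sub, trace_add, trace_sub, Complex.add_re, Complex.sub_re,
    conjTranspose_sub, conjTranspose_mul, sub_mul]
  rw [k1, k2, t1, t2]
  ring

variable {A : ι → Matrix n n ℂ} {ε : ℝ} {W : Matrix n n ℂ}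

theorem conj_sub_self_eq (hW : (1 - (ε : ℂ) • moment A) * W = 1) (i : ι) :
    (1 - (ε : ℂ) • moment A) * A i * W - A i =
      -(ε : ℂ) • ((moment A * A i - A i * moment A) * W) := by
  have h : A i = A i * ((1 - (ε : ℂ) • moment A) * W) := by rw [hW, Matrix.mul_one]
  conv_lhs => rw [sub_eq_add_neg]; arg 2; rw [h]
  simp only [sub_mul, mul_sub, Matrix.one_mul, smul_mul_assoc, mul_smul_comm,
    smul_sub, neg_smul, Matrix.mul_assoc]
  abel

theorem mul_resolvent_bounds (hε0 : 0 ≤ ε) (hε : ε * ‖moment A‖ ≤ 1 / 100)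
    (hW : (1 - (ε : ℂ) • moment A) * W = 1) (D : Matrix n n ℂ) :
    ‖D * W‖ ≤ 2 * ‖D‖ ∧ 9 / 10 * ‖D‖ ^ 2 ≤ (trace (Dᴴ * (D * W))).re := by
  have hW' : W * (1 - (ε : ℂ) • moment A) = 1 := mul_eq_one_comm.1 hW
  have h1 : D * W = D + (ε : ℂ) • (D * W * moment A) := by
    have : D = D * W * (1 - (ε : ℂ) • moment A) := by
      rw [Matrix.mul_assoc, hW', Matrix.mul_one]
    conv_rhs => arg 1; rw [this]
    rw [mul_sub, Matrix.mul_one, mul_smul_comm]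
    abel
  have h2 : ‖(ε : ℂ) • (D * W * moment A)‖ ≤ 1 / 100 * ‖D * W‖ := by
    rw [norm_smul, Complex.norm_real, Real.norm_of_nonneg hε0]
    calc ε * ‖D * W * moment A‖ ≤ ε * (‖D * W‖ * ‖moment A‖) := by
          gcongr; exact frobenius_norm_mul _ _
      _ = ε * ‖moment A‖ * ‖D * W‖ := by ring
      _ ≤ _ := by gcongr
  have h3 : ‖D * W‖ ≤ ‖D‖ + 1 / 100 * ‖D * W‖ := by
    conv_lhs => rw [h1]
    exact (norm_add_le _ _).trans (by gcongr)
  have h4 : ‖D * W‖ ≤ 2 * ‖D‖ := by linarith [norm_nonneg D]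
  refine ⟨h4, ?_⟩
  rw [h1, mul_add, trace_add, Complex.add_re, ← frobenius_sq_eq_trace]
  have h5 := re_trace_conjTranspose_mul_le D (-((ε : ℂ) • (D * W * moment A)))
  rw [mul_neg, trace_neg, Complex.neg_re, norm_neg] at h5
  have h6 : ‖D‖ * ‖(ε : ℂ) • (D * W * moment A)‖ ≤ ‖D‖ * (1 / 100 * (2 * ‖D‖)) := by
    gcongr
    linarith
  nlinarith [sq_nonneg ‖D‖]

/-- One small step of gradient descent for the moment map: the displacement is at most twice the
step length, and the squared norm of the moment map decreases accordingly. -/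
theorem moment_descent (hε0 : 0 ≤ ε) (hε : ε * (1 + ∑ i, ‖A i‖ ^ 2) ≤ 1 / 200)
    (hW : (1 - (ε : ℂ) • moment A) * W = 1) :
    (∑ i, ‖(1 - (ε : ℂ) • moment A) * A i * W - A i‖ ^ 2 ≤
      4 * ε ^ 2 * ∑ i, ‖moment A * A i - A i * moment A‖ ^ 2) ∧
    ‖moment fun i => (1 - (ε : ℂ) • moment A) * A i * W‖ ^ 2 ≤
      ‖moment A‖ ^ 2 - 2 * ε * ∑ i, ‖moment A * A i - A i * moment A‖ ^ 2 := by
  set S := ∑ i, ‖A i‖ ^ 2 with hS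
  have hS0 : 0 ≤ S := Finset.sum_nonneg fun i _ => sq_nonneg _
  have hm := frobenius_moment_le A
  rw [← hS] at hm
  have hεS : ε * S ≤ 1 / 200 := by linarith
  have hεm : ε * ‖moment A‖ ≤ 1 / 100 := by
    have := mul_le_mul_of_nonneg_left hm hε0
    linarith
  set D : ι → Matrix n n ℂ := fun i => moment A * A i - A i * moment A with hD
  set E : ι → Matrix n n ℂ := fun i => (1 - (ε : ℂ) • moment A) * A i * W - A i with hE
  have hED : ∀ i, E i = -(ε : ℂ) • (D i * W) := conj_sub_self_eq hW
  have hb := fun i => mul_resolvent_bounds hε0 hεm hW (D i)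
  have hE1 : ∀ i, ‖E i‖ ^ 2 ≤ 4 * ε ^ 2 * ‖D i‖ ^ 2 := fun i => by
    rw [hED, norm_smul, norm_neg, Complex.norm_real, Real.norm_of_nonneg hε0]
    have := mul_le_mul_of_nonneg_left (hb i).1 hε0
    calc (ε * ‖D i * W‖) ^ 2 ≤ (ε * (2 * ‖D i‖)) ^ 2 := by gcongr
      _ = _ := by ring
  set δ2 := ∑ i, ‖D i‖ ^ 2 with hδ2
  set e2 := ∑ i, ‖E i‖ ^ 2 with he2
  have hδ0 : 0 ≤ δ2 := Finset.sum_nonneg fun i _ => sq_nonneg _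
  have he0 : 0 ≤ e2 := Finset.sum_nonneg fun i _ => sq_nonneg _
  have hEs : e2 ≤ 4 * ε ^ 2 * δ2 := by
    rw [hδ2, Finset.mul_sum]
    exact Finset.sum_le_sum fun i _ => hE1 i
  refine ⟨hEs, ?_⟩
  have hA' : (fun i => (1 - (ε : ℂ) • moment A) * A i * W) = fun i => A i + E i := by
    funext i; simp [hE]
  rw [hA', moment_add]
  set L := ∑ i, (A i * (E i)ᴴ + E i * (A i)ᴴ - (A i)ᴴ * E i - (E i)ᴴ * A i) with hL
  have hmL : (trace ((moment A)ᴴ * L)).re ≤ -(9 / 5) * ε * δ2 := by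
    rw [hL, Matrix.mul_sum, trace_sum, Complex.re_sum, hδ2, Finset.mul_sum]
    refine Finset.sum_le_sum fun i _ => ?_
    rw [re_trace_mul_moment_derivative (isHermitian_moment A)]
    change 2 * (trace ((D i)ᴴ * E i)).re ≤ _
    have h1 := mul_le_mul_of_nonneg_left (hb i).2 hε0
    have h2 : (trace ((D i)ᴴ * E i)).re = -(ε * (trace ((D i)ᴴ * (D i * W))).re) := by
      rw [hED, mul_smul_comm, trace_smul, ← Complex.ofReal_neg, smul_eq_mul, Complex.re_ofReal_mul]
      ring
    rw [h2]
    linarith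
  have hLn : ‖L‖ ^ 2 ≤ 16 * (S * e2) := by
    have h1 : ‖L‖ ≤ 4 * ∑ i, ‖A i‖ * ‖E i‖ := by
      rw [Finset.mul_sum]
      refine (norm_sum_le _ _).trans (Finset.sum_le_sum fun i _ => ?_)
      have a1 := frobenius_norm_mul (A i) (E i)ᴴ
      have a2 := frobenius_norm_mul (E i) (A i)ᴴ
      have a3 := frobenius_norm_mul (A i)ᴴ (E i)
      have a4 := frobenius_norm_mul (E i)ᴴ (A i)
      rw [frobenius_norm_conjTranspose] at a1 a2 a3 a4
      have b1 := norm_sub_le (A i * (E i)ᴴ + E i * (A i)ᴴ - (A i)ᴴ * E i) ((E i)ᴴ * A i)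
      have b2 := norm_sub_le (A i * (E i)ᴴ + E i * (A i)ᴴ) ((A i)ᴴ * E i)
      have b3 := norm_add_le (A i * (E i)ᴴ) (E i * (A i)ᴴ)
      linarith
    have h2 := Finset.sum_mul_sq_le_sq_mul_sq Finset.univ (fun i => ‖A i‖) (fun i => ‖E i‖)
    calc ‖L‖ ^ 2 ≤ (4 * ∑ i, ‖A i‖ * ‖E i‖) ^ 2 := by gcongr
      _ = 16 * (∑ i, ‖A i‖ * ‖E i‖) ^ 2 := by ring
      _ ≤ _ := by gcongr
  have hQ : ‖moment E‖ ≤ 2 * e2 := frobenius_moment_le E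
  have hmQ : (trace ((moment A)ᴴ * moment E)).re ≤ 2 * S * (2 * e2) :=
    (re_trace_conjTranspose_mul_le _ _).trans (by gcongr)
  have hδS : δ2 ≤ 16 * S ^ 3 := by
    have h1 : ∀ i, ‖D i‖ ^ 2 ≤ 16 * S ^ 2 * ‖A i‖ ^ 2 := fun i => by
      have a1 := frobenius_norm_mul (moment A) (A i)
      have a2 := frobenius_norm_mul (A i) (moment A)
      have a3 : ‖D i‖ ≤ 4 * S * ‖A i‖ := by
        have := norm_sub_le (moment A * A i) (A i * moment A)
        have := mul_le_mul_of_nonneg_right hm (norm_nonneg (A i))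
        simp only [hD]
        linarith
      calc ‖D i‖ ^ 2 ≤ (4 * S * ‖A i‖) ^ 2 := by gcongr
        _ = _ := by ring
    calc δ2 ≤ ∑ i, 16 * S ^ 2 * ‖A i‖ ^ 2 := Finset.sum_le_sum fun i _ => h1 i
      _ = 16 * S ^ 3 := by rw [← Finset.mul_sum]; ring
  have hLQ : ‖L + moment E‖ ^ 2 ≤ 2 * ‖L‖ ^ 2 + 2 * ‖moment E‖ ^ 2 := by
    have h1 := pow_le_pow_left₀ (norm_nonneg _) (norm_add_le L (moment E)) 2
    nlinarith [sq_nonneg (‖L‖ - ‖moment E‖)]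
  rw [frobenius_add_sq, mul_add, trace_add, Complex.add_re]
  have := descent_estimate hS0 hε0 hδ0 he0 hεS hEs hδS hLn (norm_nonneg (moment E)) hQ hLQ hmL hmQ
  linarith

/-- The gradient step moves a tuple by at most the decrease of a multiple of `√‖moment‖`. -/
theorem dist_conj_le (hε0 : 0 ≤ ε) (hε : ε * (1 + ∑ i, ‖A i‖ ^ 2) ≤ 1 / 200)
    (hW : (1 - (ε : ℂ) • moment A) * W = 1) :
    dist A (fun i => (1 - (ε : ℂ) • moment A) * A i * W) ≤
      4 * √((Fintype.card n : ℝ) ^ 3 * ((Fintype.card n : ℝ) + 1) ^ 2) *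
        (√‖moment A‖ - √‖moment fun i => (1 - (ε : ℂ) • moment A) * A i * W‖) := by
  obtain ⟨h1, h2⟩ := moment_descent hε0 hε hW
  set δ2 := ∑ i, ‖moment A * A i - A i * moment A‖ ^ 2 with hδ2
  have hδ0 : 0 ≤ δ2 := Finset.sum_nonneg fun i _ => sq_nonneg _
  have hs : ∀ x : ℝ, 0 ≤ x → √x ^ 4 = x ^ 2 := fun x hx => by
    rw [show 4 = 2 * 2 from rfl, pow_mul, Real.sq_sqrt hx]
  have hbase := le_sqrt_mul_sub_of_descent (x := √‖moment A‖)
    (x' := √‖moment fun i => (1 - (ε : ℂ) • moment A) * A i * W‖)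
    (C := (Fintype.card n : ℝ) ^ 3 * ((Fintype.card n : ℝ) + 1) ^ 2) (ε := ε) (δ := √δ2)
    (e := 2 * ε * √δ2)
    (Real.sqrt_nonneg _) (Real.sqrt_nonneg _) (by positivity) hε0 (Real.sqrt_nonneg _)
    (by
      rw [Real.sq_sqrt hδ0, show 6 = 2 * 3 from rfl, pow_mul, Real.sq_sqrt (norm_nonneg _)]
      exact frobenius_moment_pow_three_le A)
    (by
      rw [Real.sq_sqrt hδ0, hs _ (norm_nonneg _), hs _ (norm_nonneg _)]
      exact h2) le_rfl
  refine le_trans ((dist_pi_le_iff (by positivity)).2 fun i => ?_) hbase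
  rw [dist_comm, dist_eq_norm]
  refine (sq_le_sq₀ (norm_nonneg _) (by positivity)).1 ?_
  rw [mul_pow, Real.sq_sqrt hδ0]
  calc ‖(1 - (ε : ℂ) • moment A) * A i * W - A i‖ ^ 2
      ≤ ∑ i, ‖(1 - (ε : ℂ) • moment A) * A i * W - A i‖ ^ 2 :=
        Finset.single_le_sum (f := fun i => ‖(1 - (ε : ℂ) • moment A) * A i * W - A i‖ ^ 2)
          (fun i _ => sq_nonneg _) (Finset.mem_univ i)
    _ ≤ _ := h1
    _ = _ := by ring

/-- A fixed point of the gradient step is a zero of the moment map. -/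
theorem moment_eq_zero_of_conj_eq (hε0 : 0 < ε) (hε : ε * (1 + ∑ i, ‖A i‖ ^ 2) ≤ 1 / 200)
    (hW : (1 - (ε : ℂ) • moment A) * W = 1)
    (hfix : (fun i => (1 - (ε : ℂ) • moment A) * A i * W) = A) : moment A = 0 := by
  have h2 := (moment_descent hε0.le hε hW).2
  rw [hfix] at h2
  have hδ0 : 0 ≤ ∑ i, ‖moment A * A i - A i * moment A‖ ^ 2 :=
    Finset.sum_nonneg fun i _ => sq_nonneg _
  have h3 := frobenius_moment_pow_three_le A
  have h4 : ∑ i, ‖moment A * A i - A i * moment A‖ ^ 2 = 0 := by nlinarith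
  rw [h4, mul_zero] at h3
  by_contra hne
  have : 0 < ‖moment A‖ ^ 3 := pow_pos (norm_pos_iff.2 hne) 3
  linarith

end Step

section Representation

open Filter Topology Set

theorem exists_deformation_of_isClosedEmbedding {X E : Type*} [TopologicalSpace X] [MetricSpace E]
    [CompleteSpace E] {r : X → E} (hr : IsClosedEmbedding r) {Φ : X × unitInterval → X} {y : X → ℝ}
    (hΦ : Continuous Φ) (hy : Continuous y) (hy0 : ∀ x, 0 ≤ y x)
    (hd : ∀ x s, dist (r x) (r (Φ (x, s))) ≤ y x - y (Φ (x, s)))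
    (h0 : ∀ x, Φ (x, 0) = x) (h1 : ∀ x, Φ (x, 1) = x → y x = 0) :
    ∃ H : X × unitInterval → X, Continuous H ∧ (∀ x, H (x, 0) = x) ∧ (∀ x, y (H (x, 1)) = 0) ∧
      (∀ x, y x = 0 → ∀ t, H (x, t) = x) ∧
      ∀ σ : X → X, Continuous σ → (∀ x s, σ (Φ (x, s)) = Φ (σ x, s)) →
        ∀ x t, σ (H (x, t)) = H (σ x, t) := by
  let _ : MetricSpace X := hr.isEmbedding.comapMetricSpace r
  have hiso : Isometry r := Isometry.of_dist_eq fun _ _ => rfl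
  have : CompleteSpace X :=
    (completeSpace_iff_isComplete_range hiso.isUniformInducing).2 hr.isClosed_range.isComplete
  exact exists_deformation_of_descent hΦ hy hy0 hd h0 h1

variable {Γ : Type} [Group Γ] {n : ℕ}

theorem RepSL.map_inv (ρ : RepSL Γ n) (γ : Γ) : ρ.1 γ⁻¹ = (ρ.1 γ)⁻¹ := by
  refine (Matrix.inv_eq_right_inv ?_).symm
  rw [← ρ.2.2.1, mul_inv_cancel, ρ.2.1]

theorem RepSL.map_inv_eq_adjugate (ρ : RepSL Γ n) (γ : Γ) : ρ.1 γ⁻¹ = (ρ.1 γ).adjugate := by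
  rw [ρ.map_inv, Matrix.inv_def, ρ.2.2.2, Ring.inverse_one, one_smul]

theorem RepSL.commute_of_closure {S : Set Γ} (hS : Subgroup.closure S = ⊤) (ρ : RepSL Γ n)
    {R : Matrix (Fin n) (Fin n) ℂ} (h : ∀ s ∈ S, Commute R (ρ.1 s)) (γ : Γ) :
    Commute R (ρ.1 γ) := by
  have hγ : γ ∈ Subgroup.closure S := hS ▸ Subgroup.mem_top γ
  induction hγ using Subgroup.closure_induction with
  | mem s hs => exact h s hs
  | one => rw [ρ.2.1]; exact Commute.one_right R
  | mul a b _ _ ha hb => rw [ρ.2.2.1]; exact ha.mul_right hb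
  | inv a _ ha =>
    have h1 : ρ.1 a * ρ.1 a⁻¹ = 1 := by rw [← ρ.2.2.1, mul_inv_cancel, ρ.2.1]
    have h2 : ρ.1 a⁻¹ * ρ.1 a = 1 := by rw [← ρ.2.2.1, inv_mul_cancel, ρ.2.1]
    calc R * ρ.1 a⁻¹ = ρ.1 a⁻¹ * (ρ.1 a * R) * ρ.1 a⁻¹ := by
          rw [← Matrix.mul_assoc, h2, Matrix.one_mul]
      _ = ρ.1 a⁻¹ * R * (ρ.1 a * ρ.1 a⁻¹) := by rw [← ha.eq]; simp only [Matrix.mul_assoc]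
      _ = ρ.1 a⁻¹ * R := by rw [h1, Matrix.mul_one]

theorem RepSL.ext_of_closure {S : Set Γ} (hS : Subgroup.closure S = ⊤) {ρ σ : RepSL Γ n}
    (h : ∀ s ∈ S, ρ.1 s = σ.1 s) : ρ = σ := by
  refine Subtype.ext (funext fun γ => ?_)
  have hγ : γ ∈ Subgroup.closure S := hS ▸ Subgroup.mem_top γ
  induction hγ using Subgroup.closure_induction with
  | mem s hs => exact h s hs
  | one => rw [ρ.2.1, σ.2.1]
  | mul a b _ _ ha hb => rw [ρ.2.2.1, σ.2.2.1, ha, hb]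
  | inv a _ ha => rw [ρ.map_inv, σ.map_inv, ha]

/-- Restricting to a generating set embeds the representation space as a closed subspace. -/
theorem RepSL.isClosedEmbedding_restrict {S : Set Γ} (hS : Subgroup.closure S = ⊤) :
    IsClosedEmbedding fun (ρ : RepSL Γ n) (s : S) => ρ.1 s := by
  have hcont : ∀ γ, Continuous fun ρ : RepSL Γ n => ρ.1 γ := fun γ =>
    (continuous_apply γ).comp continuous_subtype_val
  have hc : Continuous fun (ρ : RepSL Γ n) (s : S) => ρ.1 s := continuous_pi fun s => hcont s
  refine IsClosedEmbedding.of_continuous_injective_isClosedMap hc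
    (fun ρ σ h => RepSL.ext_of_closure hS fun s hs => congrFun h ⟨s, hs⟩)
    (IsProperMap.isClosedMap (isProperMap_iff_ultrafilter.2 ⟨hc, fun 𝒰 y hy => ?_⟩))
  have hy' := tendsto_pi_nhds.1 hy
  have hlim : ∀ γ, ∃ a, Tendsto (fun ρ : RepSL Γ n => ρ.1 γ) 𝒰 (𝓝 a) := by
    intro γ
    have hγ : γ ∈ Subgroup.closure S := hS ▸ Subgroup.mem_top γ
    induction hγ using Subgroup.closure_induction with
    | mem s hs => exact ⟨_, hy' ⟨s, hs⟩⟩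
    | one => exact ⟨1, tendsto_const_nhds.congr fun ρ => ρ.2.1.symm⟩
    | mul a b _ _ ha hb =>
      obtain ⟨x, hx⟩ := ha
      obtain ⟨z, hz⟩ := hb
      exact ⟨x * z, (hx.mul hz).congr fun ρ => (ρ.2.2.1 a b).symm⟩
    | inv a _ ha =>
      obtain ⟨x, hx⟩ := ha
      exact ⟨x.adjugate, (((continuous_id.matrix_adjugate).tendsto x).comp hx).congr fun ρ =>
        (ρ.map_inv_eq_adjugate a).symm⟩
  choose a ha using hlim
  refine ⟨⟨a, ?_, fun γ₁ γ₂ => ?_, fun γ => ?_⟩, funext fun s => ?_, ?_⟩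
  · exact tendsto_nhds_unique (ha 1) (tendsto_const_nhds.congr fun ρ => ρ.2.1.symm)
  · exact tendsto_nhds_unique (ha _)
      (((ha γ₁).mul (ha γ₂)).congr fun ρ => (ρ.2.2.1 γ₁ γ₂).symm)
  · exact tendsto_nhds_unique ((continuous_id.matrix_det.tendsto _).comp (ha γ))
      (tendsto_const_nhds.congr fun ρ => (ρ.2.2.2 γ).symm)
  · exact tendsto_nhds_unique (ha s) (hy' s)
  · rw [nhds_subtype_eq_comap]
    exact tendsto_iff_comap.1 (tendsto_pi_nhds.2 ha)

/-- Conjugation of a representation by an invertible matrix. -/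
noncomputable def RepSL.conj (g : Matrix (Fin n) (Fin n) ℂ) (hg : IsUnit g.det) (ρ : RepSL Γ n) :
    RepSL Γ n :=
  ⟨fun γ => g * ρ.1 γ * g⁻¹, by
    simp only [ρ.2.1, Matrix.mul_one, Matrix.mul_nonsing_inv _ hg],
    fun γ₁ γ₂ => by
      calc g * ρ.1 (γ₁ * γ₂) * g⁻¹ = g * ρ.1 γ₁ * (ρ.1 γ₂ * g⁻¹) := by
            rw [ρ.2.2.1]; simp only [Matrix.mul_assoc]
        _ = g * ρ.1 γ₁ * (g⁻¹ * g) * (ρ.1 γ₂ * g⁻¹) := by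
            rw [Matrix.nonsing_inv_mul _ hg, Matrix.mul_one]
        _ = g * ρ.1 γ₁ * g⁻¹ * (g * ρ.1 γ₂ * g⁻¹) := by simp only [Matrix.mul_assoc],
    fun γ => by
      rw [Matrix.det_conj (Matrix.isUnit_iff_isUnit_det g |>.2 hg), ρ.2.2.2]⟩

end Representation

section Flow

open Topology
open scoped Matrix.Norms.Frobenius

variable {n ι : Type*} [Fintype n] [DecidableEq n] [Fintype ι]

noncomputable def stepSize (A : ι → Matrix n n ℂ) : ℝ := (200 * (1 + ∑ i, ‖A i‖ ^ 2))⁻¹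

theorem stepSize_pos (A : ι → Matrix n n ℂ) : 0 < stepSize A := by
  have : 0 ≤ ∑ i, ‖A i‖ ^ 2 := Finset.sum_nonneg fun i _ => sq_nonneg _
  exact inv_pos.2 (by linarith)

theorem continuous_stepSize : Continuous (stepSize : (ι → Matrix n n ℂ) → ℝ) := by
  unfold stepSize
  refine Continuous.inv₀ (by fun_prop) fun A => ?_
  have : 0 ≤ ∑ i, ‖A i‖ ^ 2 := Finset.sum_nonneg fun i _ => sq_nonneg _
  positivity

theorem mul_stepSize_mul_le (A : ι → Matrix n n ℂ) {t : ℝ} (ht : t ≤ 1) :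
    t * stepSize A * (1 + ∑ i, ‖A i‖ ^ 2) ≤ 1 / 200 := by
  have : 0 ≤ ∑ i, ‖A i‖ ^ 2 := Finset.sum_nonneg fun i _ => sq_nonneg _
  have h : stepSize A * (1 + ∑ i, ‖A i‖ ^ 2) = 1 / 200 := by
    unfold stepSize
    field_simp
  rw [mul_assoc, h]
  linarith

/-- The matrix by which the gradient step of size `t` conjugates a tuple. -/
noncomputable def stepMatrix (A : ι → Matrix n n ℂ) (t : ℝ) : Matrix n n ℂ :=
  1 - ((t * stepSize A : ℝ) : ℂ) • moment A

theorem continuous_stepMatrix :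
    Continuous fun p : (ι → Matrix n n ℂ) × ℝ => stepMatrix p.1 p.2 := by
  unfold stepMatrix moment
  have h := continuous_stepSize.comp (continuous_fst (X := ι → Matrix n n ℂ) (Y := ℝ))
  refine continuous_const.sub (Continuous.smul (Complex.continuous_ofReal.comp
    (continuous_snd.mul h)) (continuous_finsetSum _ fun i _ => ?_))
  have h1 : Continuous fun p : (ι → Matrix n n ℂ) × ℝ => p.1 i := by fun_prop
  exact (h1.mul h1.matrix_conjTranspose).sub (h1.matrix_conjTranspose.mul h1)

theorem isUnit_det_stepMatrix (A : ι → Matrix n n ℂ) {t : ℝ} (h0 : 0 ≤ t) (h1 : t ≤ 1) :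
    IsUnit (stepMatrix A t).det := by
  rw [← Matrix.isUnit_iff_isUnit_det]
  refine isUnit_one_sub_of_norm_lt_one ?_
  have h2 := frobenius_moment_le A
  have h3 := mul_stepSize_mul_le A h1
  have h4 : 0 ≤ t * stepSize A := mul_nonneg h0 (stepSize_pos A).le
  rw [norm_smul, Complex.norm_real, Real.norm_of_nonneg h4]
  nlinarith [mul_le_mul_of_nonneg_left h2 h4]

theorem unitary_conj_mul {U : Matrix n n ℂ} (hU : U ∈ unitaryGroup n ℂ) (X Y : Matrix n n ℂ) :
    U * (X * Y) * Uᴴ = U * X * Uᴴ * (U * Y * Uᴴ) := by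
  have h : Uᴴ * U = 1 := mem_unitaryGroup_iff'.1 hU
  calc U * (X * Y) * Uᴴ = U * X * (Uᴴ * U) * Y * Uᴴ := by
        rw [h, Matrix.mul_one]; simp only [Matrix.mul_assoc]
    _ = _ := by simp only [Matrix.mul_assoc]

theorem stepSize_unitary_conj {U : Matrix n n ℂ} (hU : U ∈ unitaryGroup n ℂ)
    (A : ι → Matrix n n ℂ) : stepSize (fun i => U * A i * Uᴴ) = stepSize A := by
  simp only [stepSize, frobenius_norm_mul_unitary (U := Uᴴ) (Unitary.star_mem hU),
    frobenius_norm_unitary_mul hU]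

theorem stepMatrix_unitary_conj {U : Matrix n n ℂ} (hU : U ∈ unitaryGroup n ℂ)
    (A : ι → Matrix n n ℂ) (t : ℝ) :
    stepMatrix (fun i => U * A i * Uᴴ) t = U * stepMatrix A t * Uᴴ := by
  have h : U * Uᴴ = 1 := mem_unitaryGroup_iff.1 hU
  rw [stepMatrix, stepMatrix, stepSize_unitary_conj hU, moment_unitary_conj hU, mul_sub, sub_mul,
    Matrix.mul_one, h, mul_smul_comm, smul_mul_assoc]

end Flow

section RepresentationFlow

open Topology
open scoped Matrix.Norms.Frobenius

variable {Γ : Type} [Group Γ] {n : ℕ}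

theorem RepSL.exists_deformation_moment_eq_zero {S : Set Γ} [Fintype S]
    (hS : Subgroup.closure S = ⊤) (hn : 1 ≤ n) :
    ∃ H : RepSL Γ n × unitInterval → RepSL Γ n, Continuous H ∧ (∀ ρ, H (ρ, 0) = ρ) ∧
      (∀ ρ, moment (fun s : S => (H (ρ, 1)).1 s) = 0) ∧
      (∀ ρ : RepSL Γ n, moment (fun s : S => ρ.1 s) = 0 → ∀ t, H (ρ, t) = ρ) ∧
      ∀ U ∈ unitaryGroup (Fin n) ℂ, ∀ ρ σ : RepSL Γ n, (∀ γ, σ.1 γ = U * ρ.1 γ * Uᴴ) →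
        ∀ t γ, (H (σ, t)).1 γ = U * (H (ρ, t)).1 γ * Uᴴ := by
  set r : RepSL Γ n → S → Matrix (Fin n) (Fin n) ℂ := fun ρ s => ρ.1 s with hr
  have hr' : IsClosedEmbedding r := RepSL.isClosedEmbedding_restrict hS
  have hu : ∀ p : RepSL Γ n × unitInterval, IsUnit (stepMatrix (r p.1) p.2).det := fun p =>
    isUnit_det_stepMatrix _ p.2.2.1 p.2.2.2
  set Φ : RepSL Γ n × unitInterval → RepSL Γ n := fun p =>
    RepSL.conj (stepMatrix (r p.1) p.2) (hu p) p.1 with hΦ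
  set c : ℝ := 4 * √((Fintype.card (Fin n) : ℝ) ^ 3 * ((Fintype.card (Fin n) : ℝ) + 1) ^ 2)
    with hc
  have hc0 : 0 < c := by
    have : 0 < Fintype.card (Fin n) := by rw [Fintype.card_fin]; exact hn
    positivity
  have hg : Continuous fun p : RepSL Γ n × unitInterval => stepMatrix (r p.1) p.2 :=
    continuous_stepMatrix.comp ((hr'.continuous.comp continuous_fst).prodMk
      (continuous_subtype_val.comp continuous_snd))
  have hginv : Continuous fun p : RepSL Γ n × unitInterval => (stepMatrix (r p.1) p.2)⁻¹ := by
    simp only [Matrix.inv_def, Ring.inverse_eq_inv']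
    exact (hg.matrix_det.inv₀ fun p => (hu p).ne_zero).smul hg.matrix_adjugate
  have hΦc : Continuous Φ :=
    Continuous.subtype_mk (continuous_pi fun γ => (hg.mul ((continuous_apply γ).comp
      (continuous_subtype_val.comp continuous_fst))).mul hginv) _
  have hmc : Continuous fun ρ : RepSL Γ n => moment (r ρ) := by
    unfold moment
    refine continuous_finsetSum _ fun s _ => ?_
    have h1 : Continuous fun ρ : RepSL Γ n => r ρ s := (continuous_apply s).comp hr'.continuous
    exact (h1.mul h1.matrix_conjTranspose).sub (h1.matrix_conjTranspose.mul h1)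
  have hy0 : ∀ ρ : RepSL Γ n, c * √‖moment (r ρ)‖ = 0 ↔ moment (r ρ) = 0 := fun ρ => by
    rw [mul_eq_zero, Real.sqrt_eq_zero (norm_nonneg _), norm_eq_zero]
    simp [hc0.ne']
  have hbound : ∀ (ρ : RepSL Γ n) (t : unitInterval), 0 ≤ (t : ℝ) * stepSize (r ρ) ∧
      (t : ℝ) * stepSize (r ρ) * (1 + ∑ s, ‖r ρ s‖ ^ 2) ≤ 1 / 200 := fun ρ t =>
    ⟨mul_nonneg t.2.1 (stepSize_pos _).le, mul_stepSize_mul_le _ t.2.2⟩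
  have hd : ∀ (ρ : RepSL Γ n) (t : unitInterval), dist (r ρ) (r (Φ (ρ, t))) ≤
      c * √‖moment (r ρ)‖ - c * √‖moment (r (Φ (ρ, t)))‖ := fun ρ t => by
    rw [← mul_sub]
    exact dist_conj_le (hbound ρ t).1 (hbound ρ t).2 (Matrix.mul_nonsing_inv _ (hu (ρ, t)))
  have hΦ0 : ∀ ρ, Φ (ρ, 0) = ρ := fun ρ => by
    refine Subtype.ext (funext fun γ => ?_)
    simp [hΦ, RepSL.conj, stepMatrix]
  have hΦ1 : ∀ ρ, Φ (ρ, 1) = ρ → c * √‖moment (r ρ)‖ = 0 := fun ρ h => by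
    refine (hy0 ρ).2 (moment_eq_zero_of_conj_eq (W := (stepMatrix (r ρ) 1)⁻¹)
      (ε := 1 * stepSize (r ρ)) ?_ (hbound ρ 1).2 (Matrix.mul_nonsing_inv _ (hu (ρ, 1))) ?_)
    · rw [one_mul]; exact stepSize_pos _
    · exact congrArg r h
  obtain ⟨H, h1, h2, h3, h4, h5⟩ := exists_deformation_of_isClosedEmbedding hr' hΦc
    (y := fun ρ => c * √‖moment (r ρ)‖) (by fun_prop) (fun ρ => by positivity) hd hΦ0 hΦ1
  refine ⟨H, h1, h2, fun ρ => (hy0 _).1 (h3 ρ), fun ρ h t => h4 ρ ((hy0 ρ).2 h) t, ?_⟩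
  intro U hU ρ σ hσ t γ
  have hUU : U * Uᴴ = 1 := mem_unitaryGroup_iff.1 hU
  have hUU' : Uᴴ * U = 1 := mem_unitaryGroup_iff'.1 hU
  have hUinv : U⁻¹ = Uᴴ := Matrix.inv_eq_right_inv hUU
  have hUdet : IsUnit U.det := (Matrix.isUnit_iff_isUnit_det U).1 (IsUnit.of_mul_eq_one _ hUU)
  have hval : ∀ (τ : RepSL Γ n) γ, (RepSL.conj U hUdet τ).1 γ = U * τ.1 γ * Uᴴ := fun τ γ => by
    rw [← hUinv]; rfl
  have hσ' : σ = RepSL.conj U hUdet ρ := Subtype.ext (funext fun γ => by rw [hval, hσ])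
  have hcomm := h5 (RepSL.conj U hUdet) ?_ ?_ ρ t
  · rw [hσ', ← hcomm, hval]
  · exact Continuous.subtype_mk (continuous_pi fun γ => (continuous_const.mul
      ((continuous_apply γ).comp continuous_subtype_val)).mul continuous_const) _
  · intro τ s
    have hrτ : r (RepSL.conj U hUdet τ) = fun i => U * r τ i * Uᴴ := funext fun i => hval τ i
    refine Subtype.ext (funext fun γ => ?_)
    rw [hval]
    change U * (stepMatrix (r τ) s * τ.1 γ * (stepMatrix (r τ) s)⁻¹) * Uᴴ =
      stepMatrix (r (RepSL.conj U hUdet τ)) s * (RepSL.conj U hUdet τ).1 γ *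
        (stepMatrix (r (RepSL.conj U hUdet τ)) s)⁻¹
    rw [hrτ, stepMatrix_unitary_conj hU, hval, Matrix.mul_inv_rev, Matrix.mul_inv_rev, ← hUinv,
      Matrix.nonsing_inv_nonsing_inv _ hUdet]
    rw [hUinv, unitary_conj_mul hU, unitary_conj_mul hU, ← Matrix.mul_assoc U]
end RepresentationFlow

section Polar

open scoped Matrix.Norms.Frobenius ComplexOrder

variable {n ι : Type*} [Fintype n] [DecidableEq n] [Fintype ι]

theorem posDef_mul_conjTranspose_self {A : Matrix n n ℂ} (hA : IsUnit A.det) :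
    (A * Aᴴ).PosDef :=
  Matrix.PosDef.mul_conjTranspose_self A
    (Matrix.vecMul_injective_of_isUnit ((Matrix.isUnit_iff_isUnit_det A).2 hA))

theorem exists_unitary_diagonal_pos {A : Matrix n n ℂ} (hA : IsUnit A.det) :
    ∃ U ∈ unitaryGroup n ℂ, ∃ r : n → ℝ, (∀ j, 0 < r j) ∧
      A * Aᴴ = U * diagonal (fun j => (r j : ℂ)) * Uᴴ := by
  have h := posDef_mul_conjTranspose_self hA
  obtain ⟨U, hU, hr⟩ := exists_unitary_diagonal h.isHermitian
  exact ⟨U, hU, _, h.eigenvalues_pos, hr⟩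

theorem unitary_conj_conj {U : Matrix n n ℂ} (hU : U ∈ unitaryGroup n ℂ) (X : Matrix n n ℂ) :
    U * (Uᴴ * X * U) * Uᴴ = X := by
  have h : U * Uᴴ = 1 := mem_unitaryGroup_iff.1 hU
  calc U * (Uᴴ * X * U) * Uᴴ = (U * Uᴴ) * X * (U * Uᴴ) := by simp only [Matrix.mul_assoc]
    _ = X := by rw [h, Matrix.one_mul, Matrix.mul_one]

/-- If conjugation by `A` preserves the norms of a tuple with vanishing moment map, then the
positive part `A * Aᴴ` of `A` commutes with the tuple. -/
theorem commute_of_moment_eq_zero {A : Matrix n n ℂ} (hA : IsUnit A.det) {B C : ι → Matrix n n ℂ}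
    (hB : moment B = 0) (hC : ∀ i, A * C i = B i * A) (hn : ∀ i, ‖C i‖ = ‖B i‖) (i : ι) :
    Commute (A * Aᴴ) (B i) := by
  obtain ⟨U, hU, r, hr, hAr⟩ := exists_unitary_diagonal_pos hA
  have hU' : Uᴴ ∈ unitaryGroup n ℂ := Unitary.star_mem hU
  have h1 : Uᴴ * U = 1 := mem_unitaryGroup_iff'.1 hU
  have h2 : U * Uᴴ = 1 := mem_unitaryGroup_iff.1 hU
  set D : Matrix n n ℂ := diagonal fun j => (√(r j) : ℂ) with hD
  set D' : Matrix n n ℂ := diagonal fun j => ((√(r j))⁻¹ : ℂ) with hD'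
  have hs : ∀ j, (√(r j) : ℂ) ≠ 0 := fun j =>
    Complex.ofReal_ne_zero.2 (Real.sqrt_pos.2 (hr j)).ne'
  have hDD : D * D' = 1 := by
    rw [hD, hD', diagonal_mul_diagonal, ← diagonal_one]
    congr 1; funext j; exact mul_inv_cancel₀ (hs j)
  have hDD' : D' * D = 1 := mul_eq_one_comm.1 hDD
  have hDr : diagonal (fun j => (r j : ℂ)) = D * D := by
    rw [hD, diagonal_mul_diagonal]
    congr 1; funext j
    rw [← Complex.ofReal_mul, Real.mul_self_sqrt (hr j).le]
  have hD'H : D'ᴴ = D' := by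
    rw [hD', diagonal_conjTranspose]; congr 1; funext j; simp
  set W : Matrix n n ℂ := D' * Uᴴ * A with hW
  have hWW : W * Wᴴ = 1 := by
    calc W * Wᴴ = D' * (Uᴴ * (A * Aᴴ) * U) * D' := by
          simp only [hW, conjTranspose_mul, conjTranspose_conjTranspose, hD'H, Matrix.mul_assoc]
      _ = D' * (Uᴴ * U * (D * D) * (Uᴴ * U)) * D' := by
          rw [hAr, hDr]; simp only [Matrix.mul_assoc]
      _ = (D' * D) * (D * D') := by
          rw [h1, Matrix.one_mul, Matrix.mul_one]; simp only [Matrix.mul_assoc]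
      _ = 1 := by rw [hDD, hDD', Matrix.one_mul]
  have hWu : W ∈ unitaryGroup n ℂ := mem_unitaryGroup_iff.2 hWW
  have hWu' : Wᴴ ∈ unitaryGroup n ℂ := Unitary.star_mem hWu
  set B' : ι → Matrix n n ℂ := fun i => Uᴴ * B i * U with hB'
  have hkey : ∀ i, D * (W * C i * Wᴴ) = B' i * D := fun i => by
    calc D * (W * C i * Wᴴ) = (D * D') * Uᴴ * (A * C i) * Wᴴ := by
          simp only [hW, Matrix.mul_assoc]
      _ = Uᴴ * B i * (U * (D * D') * Uᴴ) * A * Wᴴ := by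
          rw [hDD, hC, Matrix.mul_one, h2, Matrix.mul_one, Matrix.one_mul]
          simp only [Matrix.mul_assoc]
      _ = B' i * D * (W * Wᴴ) := by simp only [hW, hB', Matrix.mul_assoc]
      _ = B' i * D := by rw [hWW, Matrix.mul_one]
  have hent : ∀ i j k, r k / r j * ‖B' i j k‖ ^ 2 = ‖(W * C i * Wᴴ) j k‖ ^ 2 := fun i j k => by
    have h := congrFun (congrFun (hkey i) j) k
    rw [hD, diagonal_mul, mul_diagonal] at h
    have h' := congrArg (fun z => ‖z‖ ^ 2) h
    simp only [norm_mul, mul_pow, Complex.norm_real, Real.norm_eq_abs, sq_abs,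
      Real.sq_sqrt (hr _).le] at h'
    rw [div_mul_eq_mul_div, div_eq_iff (hr j).ne']
    linarith
  have hmB' : moment B' = 0 := by
    have := moment_unitary_conj hU' B
    rw [hB, Matrix.mul_zero, Matrix.zero_mul, conjTranspose_conjTranspose] at this
    exact this
  have hsum : ∑ j, ∑ k, r k / r j * ∑ i, ‖B' i j k‖ ^ 2 = ∑ j, ∑ k, ∑ i, ‖B' i j k‖ ^ 2 := by
    simp only [Finset.mul_sum, hent]
    rw [← sum_frobenius_sq, ← sum_frobenius_sq]
    refine Finset.sum_congr rfl fun i _ => ?_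
    rw [frobenius_norm_mul_unitary hWu', frobenius_norm_unitary_mul hWu, hn,
      frobenius_norm_mul_unitary hU, frobenius_norm_unitary_mul hU']
  have heq : ∀ j k, B' i j k ≠ 0 → r j = r k := fun j k hjk => by
    refine eq_of_balanced_of_sum_div hr
      (a := fun j k => ∑ i, ‖B' i j k‖ ^ 2) (fun j k => Finset.sum_nonneg fun i _ => sq_nonneg _)
      (fun j => ?_) hsum j k ?_
    · rw [← moment_apply_self, hmB']; simp
    · have : 0 < ‖B' i j k‖ ^ 2 := pow_pos (norm_pos_iff.2 hjk) 2
      exact (this.trans_le (Finset.single_le_sum (f := fun i => ‖B' i j k‖ ^ 2)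
        (fun i _ => sq_nonneg _) (Finset.mem_univ i))).ne'
  have hcomm : diagonal (fun j => (r j : ℂ)) * B' i = B' i * diagonal fun j => (r j : ℂ) := by
    ext j k
    rw [diagonal_mul, mul_diagonal]
    by_cases hjk : B' i j k = 0
    · simp [hjk]
    · rw [heq j k hjk, mul_comm]
  have hBB : B i = U * B' i * Uᴴ := (unitary_conj_conj hU (B i)).symm
  rw [Commute, SemiconjBy, hAr, hBB, ← unitary_conj_mul hU, ← unitary_conj_mul hU, hcomm]

end Polar

section Commutator

open scoped ComplexOrder

variable {Γ : Type} [Group Γ] {n : ℕ}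

/-- The determinant of a representation on an invariant coordinate subspace. -/
noncomputable def RepSL.blockDet (ρ : RepSL Γ n) (V : Matrix (Fin n) (Fin n) ℂ)
    (hV : V ∈ unitaryGroup (Fin n) ℂ) (E : Matrix (Fin n) (Fin n) ℂ) (hE : E * E = E)
    (hc : ∀ γ, E * (Vᴴ * ρ.1 γ * V) = Vᴴ * ρ.1 γ * V * E) : Γ →* ℂ where
  toFun γ := (E * (Vᴴ * ρ.1 γ * V) + (1 - E)).det
  map_one' := by
    have h : Vᴴ * V = 1 := mem_unitaryGroup_iff'.1 hV
    simp [ρ.2.1, h]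
  map_mul' γ₁ γ₂ := by
    have h := unitary_conj_mul (U := Vᴴ) (Unitary.star_mem hV) (ρ.1 γ₁) (ρ.1 γ₂)
    rw [conjTranspose_conjTranspose] at h
    rw [← Matrix.det_mul, ρ.2.2.1, h]
    congr 1
    have h1 := hc γ₁
    have h2 := hc γ₂
    generalize Vᴴ * ρ.1 γ₁ * V = Y at *
    generalize Vᴴ * ρ.1 γ₂ * V = Z at *
    have e1 : E * Y * (E * Z) = E * (Y * Z) := by
      calc E * Y * (E * Z) = E * (Y * E) * Z := by simp only [Matrix.mul_assoc]
        _ = E * E * Y * Z := by rw [← h1]; simp only [Matrix.mul_assoc]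
        _ = _ := by rw [hE, Matrix.mul_assoc]
    have e2 : E * Y * E = E * Y := by rw [Matrix.mul_assoc, ← h1, ← Matrix.mul_assoc, hE]
    have e3 : E * (E * Z) = E * Z := by rw [← Matrix.mul_assoc, hE]
    simp only [add_mul, mul_add, sub_mul, mul_sub, Matrix.one_mul, Matrix.mul_one, e1, e2, e3, hE]
    abel

/-- If the positive part of a commutator commutes with the whole representation, then the
commutator acts unitarily. -/
theorem RepSL.mem_unitaryGroup_of_commute (ρ : RepSL Γ n) {a b ζ : Γ} (hζ : ζ = a * b * a⁻¹ * b⁻¹)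
    (h : ∀ γ, Commute (ρ.1 ζ * (ρ.1 ζ)ᴴ) (ρ.1 γ)) : ρ.1 ζ ∈ unitaryGroup (Fin n) ℂ := by
  obtain ⟨V, hV, r, hr, hp⟩ := exists_unitary_diagonal_pos (A := ρ.1 ζ) (by simp [ρ.2.2.2])
  have h1 : Vᴴ * V = 1 := mem_unitaryGroup_iff'.1 hV
  have h2 : V * Vᴴ = 1 := mem_unitaryGroup_iff.1 hV
  set R : Matrix (Fin n) (Fin n) ℂ := diagonal fun j => (r j : ℂ) with hR
  have hVR : Vᴴ * (ρ.1 ζ * (ρ.1 ζ)ᴴ) * V = R := by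
    rw [hp]
    simpa using unitary_conj_conj (U := Vᴴ) (Unitary.star_mem hV) R
  have hcR : ∀ γ, R * (Vᴴ * ρ.1 γ * V) = Vᴴ * ρ.1 γ * V * R := fun γ => by
    have e := fun X Y => unitary_conj_mul (U := Vᴴ) (Unitary.star_mem hV) X Y
    simp only [conjTranspose_conjTranspose] at e
    rw [← hVR, ← e, ← e, (h γ).eq]
  have hone : ∀ i, r i = 1 := fun i => by
    set E : Matrix (Fin n) (Fin n) ℂ := diagonal fun j => if r j = r i then 1 else 0 with hE
    have hEE : E * E = E := by
      rw [hE, diagonal_mul_diagonal]; congr 1; funext j; split_ifs <;> simp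
    have hEH : Eᴴ = E := by
      rw [hE, diagonal_conjTranspose]
      congr 1
      funext j
      simp only [Pi.star_apply]
      split_ifs <;> simp
    have hcE : ∀ γ, E * (Vᴴ * ρ.1 γ * V) = Vᴴ * ρ.1 γ * V * E := fun γ => by
      ext j k
      have := congrFun (congrFun (hcR γ) j) k
      rw [hR, diagonal_mul, mul_diagonal] at this
      rw [hE, diagonal_mul, mul_diagonal]
      by_cases hjk : r j = r k
      · rw [hjk, mul_comm]
      · have h0 : (Vᴴ * ρ.1 γ * V) j k = 0 := by
          have h3 : ((r j : ℂ) - r k) * (Vᴴ * ρ.1 γ * V) j k = 0 := by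
            rw [sub_mul, this]; ring
          exact (mul_eq_zero.1 h3).resolve_left (sub_ne_zero.2 fun h => hjk (by exact_mod_cast h))
        simp [h0]
    have hχ : ρ.blockDet V hV E hEE hcE ζ = 1 := by
      have e : ∀ γ, ρ.blockDet V hV E hEE hcE γ * ρ.blockDet V hV E hEE hcE γ⁻¹ = 1 := fun γ => by
        rw [← map_mul, mul_inv_cancel, map_one]
      rw [hζ, map_mul, map_mul, map_mul]
      linear_combination (ρ.blockDet V hV E hEE hcE b * ρ.blockDet V hV E hEE hcE b⁻¹) * e a + e b
    change (E * (Vᴴ * ρ.1 ζ * V) + (1 - E)).det = 1 at hχ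
    have hY := hcE ζ
    have hYR : Vᴴ * ρ.1 ζ * V * (Vᴴ * ρ.1 ζ * V)ᴴ = R := by
      rw [← hVR]
      calc _ = Vᴴ * ρ.1 ζ * (V * Vᴴ) * (ρ.1 ζ)ᴴ * V := by
            simp only [conjTranspose_mul, conjTranspose_conjTranspose, Matrix.mul_assoc]
        _ = _ := by rw [h2, Matrix.mul_one]; simp only [Matrix.mul_assoc]
    generalize Vᴴ * ρ.1 ζ * V = Y at *
    have hprod : (E * Y + (1 - E)) * (E * Y + (1 - E))ᴴ = E * R + (1 - E) := by
      have e1 : E * Y * E = E * Y := by rw [Matrix.mul_assoc, ← hY, ← Matrix.mul_assoc, hEE]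
      have hY2 : E * Yᴴ = Yᴴ * E := by
        have := congrArg conjTranspose hY
        rw [conjTranspose_mul, conjTranspose_mul, hEH] at this
        exact this.symm
      have e2 : E * (Yᴴ * E) = Yᴴ * E := by rw [← hY2, ← Matrix.mul_assoc, hEE]
      have e3 : E * Y * (Yᴴ * E) = E * R := by
        rw [← hY2, ← Matrix.mul_assoc, e1, Matrix.mul_assoc, hYR]
      simp only [conjTranspose_add, conjTranspose_sub, conjTranspose_mul, conjTranspose_one, hEH,
        add_mul, mul_add, sub_mul, mul_sub, Matrix.one_mul, Matrix.mul_one, e1, e2, e3, hEE]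
      abel
    have hdet : (E * R + (1 - E)).det = 1 := by
      rw [← hprod, Matrix.det_mul, Matrix.det_conjTranspose, hχ]; simp
    have hdiag : E * R + (1 - E) = diagonal fun j => ((if r j = r i then r i else 1 : ℝ) : ℂ) := by
      rw [hE, hR, diagonal_mul_diagonal, ← diagonal_one, diagonal_sub, diagonal_add]
      congr 1; funext j
      split_ifs with hj
      · simp [hj]
      · simp
    rw [hdiag, Matrix.det_diagonal, ← Complex.ofReal_prod] at hdet
    have hdet' : ∏ j, (if r j = r i then r i else 1) = 1 := by exact_mod_cast hdet
    rw [Finset.prod_ite, Finset.prod_const, Finset.prod_const_one, mul_one] at hdet'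
    refine (pow_eq_one_iff_of_nonneg (hr i).le (Finset.card_ne_zero_of_mem (a := i) ?_)).1 hdet'
    simp
  refine mem_unitaryGroup_iff.2 ?_
  have hR1 : R = 1 := by
    rw [hR, ← diagonal_one]; congr 1; funext j; rw [hone j, Complex.ofReal_one]
  rw [Matrix.star_eq_conjTranspose, hp, hR1, Matrix.mul_one, h2]

end Commutator

section Nilpotent

open scoped Matrix.Norms.Frobenius

variable {Γ : Type} [Group Γ] {n : ℕ}

theorem RepSL.commute_of_mem_upperCentralSeries {S : Set Γ} [Fintype S]
    (hS : Subgroup.closure S = ⊤) (ρ : RepSL Γ n) (hρ : moment (fun s : S => ρ.1 s) = 0) (k : ℕ) :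
    ∀ γ ∈ Subgroup.upperCentralSeries Γ k, ∀ γ', Commute (ρ.1 γ * (ρ.1 γ)ᴴ) (ρ.1 γ') := by
  induction k with
  | zero =>
    intro γ hγ γ'
    rw [Subgroup.upperCentralSeries_zero, Subgroup.mem_bot] at hγ
    rw [hγ, ρ.2.1, conjTranspose_one, Matrix.mul_one]
    exact Commute.one_left _
  | succ k ih =>
    intro γ hγ
    have hu : ∀ s, ρ.1 (γ⁻¹ * s * γ * s⁻¹) ∈ unitaryGroup (Fin n) ℂ := fun s => by
      refine ρ.mem_unitaryGroup_of_commute (a := γ⁻¹) (b := s) (by rw [inv_inv]) (ih _ ?_)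
      have := Subgroup.mem_upperCentralSeries_succ_iff.1 (inv_mem hγ) s
      rwa [commutatorElement_def, inv_inv] at this
    refine ρ.commute_of_closure hS fun s hs => ?_
    refine commute_of_moment_eq_zero (by simp [ρ.2.2.2]) hρ
      (C := fun s : S => ρ.1 (γ⁻¹ * s * γ)) (fun s => ?_) (fun s => ?_) ⟨s, hs⟩
    · rw [← ρ.2.2.1, ← ρ.2.2.1]; group
    · have : γ⁻¹ * s * γ = γ⁻¹ * s * γ * (s : Γ)⁻¹ * s := by group
      rw [this, ρ.2.2.1, frobenius_norm_unitary_mul (hu s)]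

end Nilpotent

section PolarPath

open NormedSpace
open scoped ComplexOrder

variable {n : Type*} [Fintype n] [DecidableEq n]

section Log

open scoped Matrix.Norms.L2Operator

/-- The logarithm of a hermitian matrix. -/
noncomputable def hermLog (P : Matrix n n ℂ) : Matrix n n ℂ := cfc Real.log P

theorem isHermitian_hermLog (P : Matrix n n ℂ) : (hermLog P).IsHermitian :=
  cfc_predicate (R := ℝ) (p := IsSelfAdjoint) Real.log P

theorem hermLog_exp {L : Matrix n n ℂ} (hL : L.IsHermitian) : hermLog (exp L) = L :=
  CFC.log_exp L hL

theorem continuousOn_hermLog :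
    ContinuousOn (hermLog : Matrix n n ℂ → Matrix n n ℂ) {P | P.IsHermitian ∧ IsUnit P} :=
  CFC.continuousOn_log

theorem continuous_matrix_exp : Continuous (exp : Matrix n n ℂ → Matrix n n ℂ) :=
  letI := NormedAlgebra.restrictScalars ℚ ℂ (Matrix n n ℂ)
  exp_continuous

end Log

theorem commute_hermLog {P X : Matrix n n ℂ} (h : Commute P X) : Commute (hermLog P) X :=
  h.cfc_real Real.log

theorem exp_unitary_conj {U : Matrix n n ℂ} (hU : U ∈ unitaryGroup n ℂ) (X : Matrix n n ℂ) :
    exp (U * X * Uᴴ) = U * exp X * Uᴴ := by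
  have h : U * Uᴴ = 1 := mem_unitaryGroup_iff.1 hU
  rw [← Matrix.inv_eq_right_inv h]
  exact Matrix.exp_conj U X (IsUnit.of_mul_eq_one _ h)

theorem exp_hermLog {A : Matrix n n ℂ} (hA : IsUnit A.det) : exp (hermLog (A * Aᴴ)) = A * Aᴴ := by
  obtain ⟨U, hU, r, hr, h⟩ := exists_unitary_diagonal_pos hA
  have hexp : exp (U * diagonal (fun j => (Real.log (r j) : ℂ)) * Uᴴ) = A * Aᴴ := by
    rw [h, exp_unitary_conj hU, Matrix.exp_diagonal]
    congr 3
    funext j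
    rw [Pi.coe_exp, ← Complex.exp_eq_exp_ℂ, ← Complex.ofReal_exp, Real.exp_log (hr j)]
  rw [← hexp, hermLog_exp]
  have : (diagonal fun j => (Real.log (r j) : ℂ)).IsHermitian := by
    rw [IsHermitian, diagonal_conjTranspose]; congr 1; funext j; simp
  exact isHermitian_mul_mul_conjTranspose U this

theorem det_exp_smul_eq_one {L : Matrix n n ℂ} (hL : L.IsHermitian) (h : (exp L).det = 1) (c : ℝ) :
    (exp (c • L)).det = 1 := by
  obtain ⟨U, hU, hLU⟩ := exists_unitary_diagonal hL
  have hUU : U * Uᴴ = 1 := mem_unitaryGroup_iff.1 hU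
  have key : ∀ c : ℝ, (exp (c • L)).det = (Real.exp (c * ∑ j, hL.eigenvalues j) : ℂ) := fun c => by
    have : c • L = U * diagonal (fun j => ((c * hL.eigenvalues j : ℝ) : ℂ)) * Uᴴ := by
      conv_lhs => rw [hLU]
      rw [← smul_mul_assoc, ← mul_smul_comm, ← diagonal_smul]
      congr 3; funext j; simp
    rw [this, exp_unitary_conj hU, Matrix.det_mul_right_comm, hUU, Matrix.one_mul,
      Matrix.exp_diagonal, Matrix.det_diagonal, Finset.mul_sum, Real.exp_sum, Complex.ofReal_prod]
    refine Finset.prod_congr rfl fun j _ => ?_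
    rw [Pi.coe_exp, ← Complex.exp_eq_exp_ℂ, Complex.ofReal_exp]
  have h1 := key 1
  rw [one_smul, h, one_mul] at h1
  have h2 : Real.exp (∑ j, hL.eigenvalues j) = 1 := by exact_mod_cast h1.symm
  rw [key, Real.exp_eq_one_iff _ |>.1 h2]
  simp

/-- The path `s ↦ (A * Aᴴ) ^ (-s / 2) * A` from an invertible matrix to its unitary polar part. -/
noncomputable def polarPath (s : ℝ) (A : Matrix n n ℂ) : Matrix n n ℂ :=
  exp ((-s / 2) • hermLog (A * Aᴴ)) * A

theorem polarPath_zero (A : Matrix n n ℂ) : polarPath 0 A = A := by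
  simp [polarPath]

theorem polarPath_of_mem_unitaryGroup {A : Matrix n n ℂ} (hA : A ∈ unitaryGroup n ℂ) (s : ℝ) :
    polarPath s A = A := by
  have h : A * Aᴴ = 1 := mem_unitaryGroup_iff.1 hA
  have h0 : hermLog (1 : Matrix n n ℂ) = 0 := by
    rw [← exp_zero, hermLog_exp Matrix.isHermitian_zero]
  simp [polarPath, h, h0]

theorem polarPath_one_mem_unitaryGroup {A : Matrix n n ℂ} (hA : IsUnit A.det) :
    polarPath 1 A ∈ unitaryGroup n ℂ := by
  have hL := isHermitian_hermLog (A * Aᴴ)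
  have hq : (exp ((-1 / 2 : ℝ) • hermLog (A * Aᴴ)))ᴴ = exp ((-1 / 2 : ℝ) • hermLog (A * Aᴴ)) := by
    rw [← Matrix.exp_conjTranspose, conjTranspose_smul, hL.eq, star_trivial]
  rw [mem_unitaryGroup_iff, Matrix.star_eq_conjTranspose, polarPath, conjTranspose_mul, hq]
  have hc : ∀ a b : ℝ, Commute (a • hermLog (A * Aᴴ)) (b • hermLog (A * Aᴴ)) := fun a b =>
    ((Commute.refl _).smul_left a).smul_right b
  calc exp ((-1 / 2 : ℝ) • hermLog (A * Aᴴ)) * A * (Aᴴ * exp ((-1 / 2 : ℝ) • hermLog (A * Aᴴ)))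
      = exp ((-1 / 2 : ℝ) • hermLog (A * Aᴴ)) * exp ((1 : ℝ) • hermLog (A * Aᴴ)) *
          exp ((-1 / 2 : ℝ) • hermLog (A * Aᴴ)) := by
        rw [one_smul, exp_hermLog hA]; simp only [Matrix.mul_assoc]
    _ = 1 := by
        rw [← Matrix.exp_add_of_commute _ _ (hc _ _), ← add_smul,
          ← Matrix.exp_add_of_commute _ _ (hc _ _), ← add_smul]
        norm_num

theorem det_polarPath {A : Matrix n n ℂ} (hA : A.det = 1) (s : ℝ) : (polarPath s A).det = 1 := by
  rw [polarPath, Matrix.det_mul, hA, mul_one]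
  refine det_exp_smul_eq_one (isHermitian_hermLog _) ?_ _
  rw [exp_hermLog (by simp [hA]), Matrix.det_mul, Matrix.det_conjTranspose, hA]
  simp

theorem polarPath_mul {A B : Matrix n n ℂ} (hA : IsUnit A.det) (hB : IsUnit B.det)
    (hAB : Commute (A * Aᴴ) B) (hBA : Commute (B * Bᴴ) A) (s : ℝ) :
    polarPath s (A * B) = polarPath s A * polarPath s B := by
  have hPH : (A * Aᴴ)ᴴ = A * Aᴴ := by rw [conjTranspose_mul, conjTranspose_conjTranspose]
  have hAB' : Commute (A * Aᴴ) Bᴴ := by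
    have := congrArg conjTranspose hAB.eq
    rw [conjTranspose_mul, conjTranspose_mul B, hPH] at this
    exact this.symm
  have hPP : Commute (A * Aᴴ) (B * Bᴴ) := hAB.mul_right hAB'
  have hLL : Commute (hermLog (A * Aᴴ)) (hermLog (B * Bᴴ)) :=
    commute_hermLog (commute_hermLog hPP.symm).symm
  have hprod : A * B * (A * B)ᴴ = exp (hermLog (A * Aᴴ) + hermLog (B * Bᴴ)) := by
    rw [Matrix.exp_add_of_commute _ _ hLL, exp_hermLog hA, exp_hermLog hB, hPP.eq]
    calc A * B * (A * B)ᴴ = A * (B * Bᴴ) * Aᴴ := by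
          simp only [conjTranspose_mul, Matrix.mul_assoc]
      _ = _ := by rw [← hBA.eq]; simp only [Matrix.mul_assoc]
  have hlog : hermLog (A * B * (A * B)ᴴ) = hermLog (A * Aᴴ) + hermLog (B * Bᴴ) := by
    rw [hprod, hermLog_exp ((isHermitian_hermLog _).add (isHermitian_hermLog _))]
  have hqA : Commute (exp ((-s / 2) • hermLog (B * Bᴴ))) A :=
    ((commute_hermLog hBA).smul_left _).exp_left
  rw [polarPath, hlog, smul_add,
    Matrix.exp_add_of_commute _ _ ((hLL.smul_left _).smul_right _), polarPath, polarPath]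
  calc _ = exp ((-s / 2) • hermLog (A * Aᴴ)) * (exp ((-s / 2) • hermLog (B * Bᴴ)) * A) * B := by
        simp only [Matrix.mul_assoc]
    _ = _ := by rw [hqA.eq]; simp only [Matrix.mul_assoc]

theorem polarPath_unitary_conj {U A : Matrix n n ℂ} (hU : U ∈ unitaryGroup n ℂ)
    (hA : IsUnit A.det) (s : ℝ) : polarPath s (U * A * Uᴴ) = U * polarPath s A * Uᴴ := by
  have h1 : U * A * Uᴴ * (U * A * Uᴴ)ᴴ = U * (A * Aᴴ) * Uᴴ := by
    rw [unitary_conj_mul hU]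
    simp only [conjTranspose_mul, conjTranspose_conjTranspose, Matrix.mul_assoc]
  have h2 : hermLog (U * (A * Aᴴ) * Uᴴ) = U * hermLog (A * Aᴴ) * Uᴴ := by
    conv_lhs => rw [← exp_hermLog hA, ← exp_unitary_conj hU]
    exact hermLog_exp (isHermitian_mul_mul_conjTranspose U (isHermitian_hermLog _))
  rw [polarPath, h1, h2, ← smul_mul_assoc, ← mul_smul_comm, exp_unitary_conj hU,
    ← unitary_conj_mul hU, polarPath]

theorem continuous_polarPath {X : Type*} [TopologicalSpace X] {s : X → ℝ} {A : X → Matrix n n ℂ}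
    (hs : Continuous s) (hA : Continuous A) (hu : ∀ x, IsUnit (A x).det) :
    Continuous fun x => polarPath (s x) (A x) := by
  unfold polarPath
  have h : Continuous fun x => hermLog (A x * (A x)ᴴ) :=
    continuousOn_hermLog.comp_continuous (hA.mul hA.matrix_conjTranspose) fun x => by
      have := posDef_mul_conjTranspose_self (hu x)
      exact ⟨this.isHermitian, this.isUnit⟩
  exact (continuous_matrix_exp.comp ((hs.neg.div_const 2).smul h)).mul hA

end PolarPath

section PolarDeformation

open Set

variable {Γ : Type} [Group Γ] {n : ℕ}

/-- Move every value of a representation along its polar path to the unitary group. -/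
noncomputable def RepSL.polar (s : ℝ) (ρ : RepSL Γ n)
    (h : s = 0 ∨ ∀ γ γ', Commute (ρ.1 γ * (ρ.1 γ)ᴴ) (ρ.1 γ')) : RepSL Γ n :=
  ⟨fun γ => polarPath s (ρ.1 γ), by
    beta_reduce
    rw [ρ.2.1]
    exact polarPath_of_mem_unitaryGroup (one_mem _) s, fun γ₁ γ₂ => by
    beta_reduce
    rw [ρ.2.2.1]
    rcases h with rfl | h
    · simp only [polarPath_zero]
    · exact polarPath_mul (by simp [ρ.2.2.2]) (by simp [ρ.2.2.2]) (h _ _) (h _ _) s,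
    fun γ => det_polarPath (ρ.2.2.2 γ) s⟩

theorem moment_eq_zero_of_mem_unitaryGroup {ι : Type*} [Fintype ι]
    {A : ι → Matrix (Fin n) (Fin n) ℂ} (hA : ∀ i, A i ∈ unitaryGroup (Fin n) ℂ) :
    moment A = 0 := by
  refine Finset.sum_eq_zero fun i _ => ?_
  rw [← Matrix.star_eq_conjTranspose, mem_unitaryGroup_iff.1 (hA i), mem_unitaryGroup_iff'.1 (hA i),
    sub_self]

end PolarDeformation

/-- Theorem I of the paper in the complex case, for `G = SL_n ℂ` and `K = SU(n)`:
for a finitely generated nilpotent group `Γ`, there is an `SU(n)`-equivariant strong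
deformation retraction of `Hom(Γ, SL_n ℂ)` onto `Hom(Γ, SU(n))`. -/
theorem theoremI_complex_SL (Γ : Type) [Group Γ] [Group.FG Γ] [Group.IsNilpotent Γ]
    (n : ℕ) (hn : 1 ≤ n) :
    ∃ H : RepSL Γ n × unitInterval → RepSL Γ n,
      Continuous H ∧
      (∀ x, H (x, 0) = x) ∧
      (∀ x γ, (H (x, 1)).1 γ ∈ Matrix.unitaryGroup (Fin n) ℂ) ∧
      (∀ a : RepSL Γ n, (∀ γ, a.1 γ ∈ Matrix.unitaryGroup (Fin n) ℂ) →
        ∀ t, H (a, t) = a) ∧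
      (∀ u : Matrix.specialUnitaryGroup (Fin n) ℂ, ∀ ρ σ : RepSL Γ n,
        (∀ γ, σ.1 γ =
            (u : Matrix (Fin n) (Fin n) ℂ) * ρ.1 γ * star (u : Matrix (Fin n) (Fin n) ℂ)) →
        ∀ t γ, (H (σ, t)).1 γ =
            (u : Matrix (Fin n) (Fin n) ℂ) * (H (ρ, t)).1 γ *
              star (u : Matrix (Fin n) (Fin n) ℂ)) := by
  obtain ⟨S, hS⟩ := Group.fg_def.1 (inferInstance : Group.FG Γ)
  obtain ⟨k, hk⟩ := Group.IsNilpotent.nilpotent Γ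
  obtain ⟨F, hF, hF0, hF1, hFfix, hFeq⟩ := RepSL.exists_deformation_moment_eq_zero (n := n) hS hn
  let t' : unitInterval → unitInterval := fun t => Set.projIcc 0 1 zero_le_one (2 * (t : ℝ))
  let s : unitInterval → ℝ := fun t => max 0 (2 * (t : ℝ) - 1)
  have ht' : Continuous t' := continuous_projIcc.comp (by fun_prop)
  have hs : Continuous s := by fun_prop
  have hst : ∀ (ρ : RepSL Γ n) t, s t = 0 ∨
      ∀ γ γ', Commute ((F (ρ, t' t)).1 γ * ((F (ρ, t' t)).1 γ)ᴴ) ((F (ρ, t' t)).1 γ') := by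
    intro ρ t
    rcases le_total (2 * (t : ℝ)) 1 with h | h
    · exact Or.inl (max_eq_left (by linarith))
    · have h1 : t' t = 1 := Set.projIcc_of_right_le _ h
      refine Or.inr fun γ γ' => ?_
      rw [h1]
      exact RepSL.commute_of_mem_upperCentralSeries hS _ (hF1 ρ) k γ (by simp [hk]) γ'
  refine ⟨fun x => RepSL.polar (s x.2) (F (x.1, t' x.2)) (hst x.1 x.2), ?_, fun ρ => ?_,
    fun ρ γ => ?_, fun ρ hρ t => ?_, fun u ρ σ hσ t γ => ?_⟩
  · refine Continuous.subtype_mk (continuous_pi fun γ => ?_) _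
    refine continuous_polarPath (hs.comp continuous_snd) ?_ fun x => by
      simp [(F (x.1, t' x.2)).2.2.2]
    exact (continuous_apply γ).comp (continuous_subtype_val.comp
      (hF.comp (continuous_fst.prodMk (ht'.comp continuous_snd))))
  · have h0 : t' 0 = 0 := Set.projIcc_of_le_left _ (by simp)
    have hs0 : s 0 = 0 := by simp [s]
    refine Subtype.ext (funext fun γ => ?_)
    simp only [RepSL.polar, h0, hs0, hF0, polarPath_zero]
  · have hs1 : s 1 = 1 := by norm_num [s]
    simp only [RepSL.polar, hs1]
    exact polarPath_one_mem_unitaryGroup (by simp [(F (ρ, t' 1)).2.2.2])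
  · refine Subtype.ext (funext fun γ => ?_)
    simp only [RepSL.polar, hFfix ρ (moment_eq_zero_of_mem_unitaryGroup fun i => hρ i)]
    exact polarPath_of_mem_unitaryGroup (hρ γ) _
  · have hu : (u : Matrix (Fin n) (Fin n) ℂ) ∈ unitaryGroup (Fin n) ℂ :=
      (Matrix.mem_specialUnitaryGroup_iff.1 u.2).1
    simp only [RepSL.polar, hFeq _ hu ρ σ hσ]
    exact polarPath_unitary_conj hu (by simp [(F (ρ, t' t)).2.2.2]) _
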